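/- Let 1 < β < 2 and let T_β : [0,1) → [0,1) be the Manneville–Pomeau map defined by T_β(x) = x + 2^{β−1}x^β for x < 1/2 and T_β(x) = 2x − 1 for x ≥ 1/2. Let α ≥ 1 and r_j = j^{−α}. Then for Lebesgue-almost every x, the Hausdorff dimension of E(x,r) equals 1/α. -/

import Mathlib

open MeasureTheory Filter Set

/-- `E(x,r)`: the set of `y ∈ [0,1]` such that `|Tⁿ x − y| < r n` for infinitely many `n`. -/
def hitSet (T : ℝ → ℝ) (x : ℝ) (r : ℕ → ℝ) : Set ℝ :=
  {y ∈ Set.Icc (0 : ℝ) 1 | ∃ᶠ n in Filter.atTop, |T^[n] x - y| < r n}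

/-- The Manneville–Pomeau map with parameter `β`, as a map on `[0,1)`. -/
noncomputable def MannevillePomeau (β : ℝ) : ℝ → ℝ :=
  fun x => if x < 1 / 2 then x + 2 ^ (β - 1) * x ^ β else 2 * x - 1

open Topology


/-- Superadditivity of increments over disjoint closed intervals. -/
lemma sum_incr_le {ι : Type*} (t : Finset ι) (c d : ι → ℝ) (F : ℝ → ℝ) (hF : Monotone F)
    (hFc : Continuous F) (a b : ℝ) (hcd : ∀ i ∈ t, c i ≤ d i) (hac : ∀ i ∈ t, a ≤ c i)
    (hdb : ∀ i ∈ t, d i ≤ b)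
    (hab : a ≤ b)
    (hdisj : (t : Set ι).PairwiseDisjoint (fun i => Icc (c i) (d i))) :
    ∑ i ∈ t, (F (d i) - F (c i)) ≤ F b - F a := by
  let G : StieltjesFunction ℝ := ⟨F, hF, fun x => hFc.continuousWithinAt⟩
  have h1 : G.measure (⋃ i ∈ t, Ioc (c i) (d i)) = ∑ i ∈ t, G.measure (Ioc (c i) (d i)) := by
    apply measure_biUnion_finset
    · intro i hi j hj hij
      exact (hdisj hi hj hij).mono Ioc_subset_Icc_self Ioc_subset_Icc_self
    · intro i _; exact measurableSet_Ioc
  have h2 : G.measure (⋃ i ∈ t, Ioc (c i) (d i)) ≤ G.measure (Ioc a b) := by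
    apply measure_mono
    intro x hx
    simp only [mem_iUnion] at hx
    obtain ⟨i, hi, hx⟩ := hx
    exact ⟨(hac i hi).trans_lt hx.1, hx.2.trans (hdb i hi)⟩
  rw [h1] at h2
  simp only [StieltjesFunction.measure_Ioc] at h2
  rw [← ENNReal.ofReal_sum_of_nonneg] at h2
  · exact (ENNReal.ofReal_le_ofReal_iff (by have := hF hab; show (0:ℝ) ≤ F b - F a; linarith)).1 h2
  · intro i hi; have := hF (hcd i hi); show (0:ℝ) ≤ F (d i) - F (c i); linarith

/-- Admissible functions in the construction. -/
def Adm (s C : ℝ) (F : ℝ → ℝ) : Prop :=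
  Monotone F ∧ (∀ x ≤ 0, F x = 0) ∧ (∀ x, 1 ≤ x → F x = F 1) ∧
  (∃ L > 0, ∀ u v, u ≤ v → F v - F u ≤ L * (v - u)) ∧
  ∀ u v, u ≤ v → F v - F u ≤ C * (v - u) ^ s

/-- Ramp function. -/
noncomputable def ramp (z r x : ℝ) : ℝ := max 0 (min 1 ((x - z + r) / (2 * r)))

lemma ramp_nonneg (z r x : ℝ) : 0 ≤ ramp z r x := le_max_left _ _
lemma ramp_le_one (z r x : ℝ) : ramp z r x ≤ 1 := max_le zero_le_one (min_le_left _ _)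
lemma ramp_mono (z r : ℝ) (hr : 0 < r) : Monotone (ramp z r) := by
  intro x y h
  unfold ramp
  gcongr
lemma ramp_zero (z r x : ℝ) (hr : 0 < r) (h : x ≤ z - r) : ramp z r x = 0 := by
  unfold ramp
  apply max_eq_left
  apply (min_le_right _ _).trans
  apply div_nonpos_of_nonpos_of_nonneg <;> linarith
lemma ramp_one (z r x : ℝ) (hr : 0 < r) (h : z + r ≤ x) : ramp z r x = 1 := by
  unfold ramp
  have : 1 ≤ (x - z + r) / (2 * r) := by rw [le_div_iff₀ (by linarith)]; linarith
  rw [min_eq_left this]; norm_num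
lemma ramp_lip (z r u v : ℝ) (hr : 0 < r) (h : u ≤ v) :
    ramp z r v - ramp z r u ≤ (v - u) / (2 * r) := by
  have e : (v - z + r) / (2 * r) = (u - z + r) / (2 * r) + (v - u) / (2 * r) := by ring
  have : 0 ≤ (v - u) / (2 * r) := div_nonneg (by linarith) (by linarith)
  unfold ramp
  rw [e]
  generalize (u - z + r) / (2 * r) = p at *
  generalize (v - u) / (2 * r) = q at *
  rcases le_total 1 p with h1 | h1 <;> rcases le_total 1 (p+q) with h2 | h2 <;>
  rcases le_total 0 p with h3 | h3 <;> rcases le_total 0 (p+q) with h4 | h4 <;>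
    simp [*] <;> linarith

lemma finite_select (B : Set ℝ) (ρ : ℝ → ℝ) (hB : B.Countable)
    (hρ : ∀ y ∈ B, 0 < ρ y)
    (hcov : volume (Ioo (0:ℝ) 1 \ ⋃ y ∈ B, Metric.closedBall y (ρ y)) = 0)
    (hd : B.PairwiseDisjoint fun y => Metric.closedBall y (ρ y)) (η : ℝ) (hη : 0 < η) :
    ∃ t : Finset ℝ, (t : Set ℝ) ⊆ B ∧ 1 - η < ∑ y ∈ t, 2 * ρ y := by
  by_cases h1 : 1 - η < 0
  · exact ⟨∅, by simp, by simpa using h1⟩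
  push Not at h1
  have h2 : (1 : ENNReal) ≤ volume (⋃ y ∈ B, Metric.closedBall y (ρ y)) := by
    have : volume (Ioo (0:ℝ) 1) ≤ volume (Ioo (0:ℝ) 1 \ ⋃ y ∈ B, Metric.closedBall y (ρ y)) + volume (⋃ y ∈ B, Metric.closedBall y (ρ y)) := by
      refine (measure_mono ?_).trans (measure_union_le _ _)
      intro x hx
      by_cases h : x ∈ ⋃ y ∈ B, Metric.closedBall y (ρ y)
      · exact Or.inr h
      · exact Or.inl ⟨hx, h⟩
    rw [hcov, zero_add] at this
    simpa using this
  rw [measure_biUnion hB hd (fun _ _ => measurableSet_closedBall)] at h2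
  rw [ENNReal.tsum_eq_iSup_sum] at h2
  have h3 : ENNReal.ofReal (1 - η) < 1 := by
    rw [← ENNReal.ofReal_one]; exact (ENNReal.ofReal_lt_ofReal_iff one_pos).2 (by linarith)
  obtain ⟨t, ht⟩ := lt_iSup_iff.1 (h3.trans_le h2)
  refine ⟨t.map (Function.Embedding.subtype _), by intro x; simp; tauto, ?_⟩
  rw [Finset.sum_map]
  simp only [Real.volume_closedBall, Function.Embedding.coe_subtype] at ht ⊢
  rw [← ENNReal.ofReal_sum_of_nonneg (fun i _ => by have := hρ i i.2; linarith)] at ht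
  exact (ENNReal.ofReal_lt_ofReal_iff_of_nonneg h1).1 ht


section core
variable (t : Finset ℝ) (ρ z r : ℝ → ℝ) (s κ η L : ℝ) (F : ℝ → ℝ)

/-- the redistributed function -/
noncomputable def redis (x : ℝ) : ℝ := ∑ y ∈ t, (F (y + ρ y) - F (y - ρ y)) * ramp (z y) (r y) x

lemma redis_mono (hF : Monotone F) (hρ : ∀ y ∈ t, 0 < ρ y) (hr : ∀ y ∈ t, 0 < r y) :
    Monotone (redis t ρ z r F) := by
  intro u v huv
  unfold redis
  apply Finset.sum_le_sum
  intro y hy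
  have := hF (show y - ρ y ≤ y + ρ y by linarith [hρ y hy])
  exact mul_le_mul_of_nonneg_left (ramp_mono _ _ (hr y hy) huv) (by linarith)

lemma redis_upper (hF : Monotone F) (hFc : Continuous F) (hL : ∀ u v, u ≤ v → F v - F u ≤ L * (v - u))
    (hL0 : 0 < L)
    (hρ : ∀ y ∈ t, 0 < ρ y ∧ ρ y < κ) (hr : ∀ y ∈ t, 0 < r y)
    (hz : ∀ y ∈ t, |z y - y| ≤ ρ y / 2) (hrρ : ∀ y ∈ t, r y ≤ ρ y / 4) (hκ : 0 < κ)
    (hb : ∀ y ∈ t, 0 < y - ρ y ∧ y + ρ y < 1)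
    (hd : (t : Set ℝ).PairwiseDisjoint fun y => Icc (y - ρ y) (y + ρ y)) (u v : ℝ) (huv : u ≤ v) :
    redis t ρ z r F v - redis t ρ z r F u ≤ F v - F u + 4 * κ * L := by
  classical
  set t' := t.filter (fun y => y - ρ y ≤ v ∧ u ≤ y + ρ y) with ht'
  have h1 : redis t ρ z r F v - redis t ρ z r F u ≤ ∑ y ∈ t', (F (y + ρ y) - F (y - ρ y)) := by
    unfold redis
    rw [← Finset.sum_sub_distrib, ht', Finset.sum_filter]
    apply Finset.sum_le_sum
    intro y hy
    have h0 := hF (show y - ρ y ≤ y + ρ y by linarith [hρ y hy])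
    have hz' := abs_le.1 (hz y hy)
    have h2 := hρ y hy
    have h3 := hrρ y hy
    split_ifs with hc
    · have := ramp_nonneg (z y) (r y) u
      have := ramp_le_one (z y) (r y) v
      nlinarith
    · rw [not_and_or] at hc
      rcases hc with hc | hc
      · rw [ramp_zero _ _ v (hr y hy) (by linarith), ramp_zero _ _ u (hr y hy) (by linarith)]; simp
      · rw [ramp_one _ _ v (hr y hy) (by linarith), ramp_one _ _ u (hr y hy) (by linarith)]; simp
  have h2 : ∑ y ∈ t', (F (y + ρ y) - F (y - ρ y)) ≤ F (v + 2 * κ) - F (u - 2 * κ) := by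
    apply sum_incr_le t' (fun y => y - ρ y) (fun y => y + ρ y) F hF hFc
    · intro y hy; have := hρ y (Finset.mem_filter.1 hy).1; linarith
    · intro y hy; have := hρ y (Finset.mem_filter.1 hy).1; have := (Finset.mem_filter.1 hy).2
      linarith
    · intro y hy; have := hρ y (Finset.mem_filter.1 hy).1; have := (Finset.mem_filter.1 hy).2
      linarith
    · linarith
    · exact hd.subset (by intro y hy; exact (Finset.mem_filter.1 hy).1)
  have h3 := hL v (v + 2 * κ) (by linarith)
  have h4 := hL (u - 2 * κ) u (by linarith)
  linarith

lemma redis_total (hF : Monotone F) (hFc : Continuous F) (hL : ∀ u v, u ≤ v → F v - F u ≤ L * (v - u))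
    (hL0 : 0 < L) (hF0 : F 0 = 0)
    (hρ : ∀ y ∈ t, 0 < ρ y ∧ ρ y < κ) (hr : ∀ y ∈ t, 0 < r y)
    (hz : ∀ y ∈ t, |z y - y| ≤ ρ y / 2) (hrρ : ∀ y ∈ t, r y ≤ ρ y / 4)
    (hb : ∀ y ∈ t, 0 < y - ρ y ∧ y + ρ y < 1) (hsum : 1 - η < ∑ y ∈ t, 2 * ρ y)
    (hd : (t : Set ℝ).PairwiseDisjoint fun y => Icc (y - ρ y) (y + ρ y)) :
    F 1 - L * η ≤ redis t ρ z r F 1 := by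
  have h1 : redis t ρ z r F 1 = ∑ y ∈ t, (F (y + ρ y) - F (y - ρ y)) := by
    unfold redis
    apply Finset.sum_congr rfl
    intro y hy
    have hz' := abs_le.1 (hz y hy)
    rw [ramp_one _ _ _ (hr y hy), mul_one]
    linarith [hb y hy, hrρ y hy, hρ y hy]
  have h2 : ∑ y ∈ t, ((L * (y + ρ y) - F (y + ρ y)) - (L * (y - ρ y) - F (y - ρ y))) ≤ (L * 1 - F 1) - (L * 0 - F 0) := by
    apply sum_incr_le t (fun y => y - ρ y) (fun y => y + ρ y) (fun x => L * x - F x)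
    · intro u v huv; have := hL u v huv; simp only; linarith
    · fun_prop
    · intro y hy; have := hρ y hy; linarith
    · intro y hy; exact (hb y hy).1.le
    · intro y hy; exact (hb y hy).2.le
    · norm_num
    · exact hd
  have h3 : ∑ y ∈ t, ((L * (y + ρ y) - F (y + ρ y)) - (L * (y - ρ y) - F (y - ρ y))) =
     L * ∑ y ∈ t, 2 * ρ y - ∑ y ∈ t, (F (y + ρ y) - F (y - ρ y)) := by
    rw [Finset.mul_sum, ← Finset.sum_sub_distrib]
    apply Finset.sum_congr rfl
    intros; ring
  rw [h1]
  nlinarith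

lemma redis_small (hs0 : 0 < s) (hs1 : s < 1) (hF : Monotone F) (hL : ∀ u v, u ≤ v → F v - F u ≤ L * (v - u))
    (hL0 : 0 < L)
    (hρ : ∀ y ∈ t, 0 < ρ y ∧ ρ y < κ) (hr : ∀ y ∈ t, 0 < r y)
    (hz : ∀ y ∈ t, |z y - y| ≤ ρ y / 2) (hrρ : ∀ y ∈ t, r y ≤ ρ y / 4) (hκ : 0 < κ)
    (hrs : ∀ y ∈ t, ρ y ≤ κ * (r y) ^ s)
    (hd : (t : Set ℝ).PairwiseDisjoint fun y => Icc (y - ρ y) (y + ρ y)) (u v : ℝ) (huv : u ≤ v) :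
    redis t ρ z r F v - redis t ρ z r F u ≤ 8 * L * (v - u) + 2 * L * κ * (v - u) ^ s := by
  classical
  have hpow : 0 ≤ (v - u) ^ s := Real.rpow_nonneg (by linarith) _
  have hm : ∀ y ∈ t, 0 ≤ F (y + ρ y) - F (y - ρ y) ∧ F (y + ρ y) - F (y - ρ y) ≤ 2 * L * ρ y := by
    intro y hy
    have h0 := hF (show y - ρ y ≤ y + ρ y by linarith [hρ y hy])
    have h1 := hL (y - ρ y) (y + ρ y) (by linarith [hρ y hy])
    constructor <;> linarith
  unfold redis
  rw [← Finset.sum_sub_distrib]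
  by_cases hA : ∃ y ∈ t, y - ρ y ≤ u ∧ v ≤ y + ρ y
  · obtain ⟨y, hy, hyu, hyv⟩ := hA
    rw [Finset.sum_eq_single_of_mem y hy]
    · have hry := hr y hy
      have key : ramp (z y) (r y) v - ramp (z y) (r y) u ≤ ((v - u) / (r y)) ^ s := by
        have h1 := ramp_lip (z y) (r y) u v hry huv
        have h2 : ramp (z y) (r y) v - ramp (z y) (r y) u ≤ 1 := by
          linarith [ramp_le_one (z y) (r y) v, ramp_nonneg (z y) (r y) u]
        have h3 : (v - u) / (2 * r y) ≤ (v - u) / r y := by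
          apply div_le_div_of_nonneg_left <;> linarith
        have h0 : 0 ≤ (v - u) / r y := div_nonneg (by linarith) hry.le
        rcases le_total ((v - u) / r y) 1 with h | h
        · calc _ ≤ (v - u) / r y := h1.trans h3
            _ = ((v - u) / r y) ^ (1:ℝ) := by simp
            _ ≤ _ := by
              rcases h0.eq_or_lt with h0 | h0
              · rw [← h0]; simp [hs0.ne']
              · exact Real.rpow_le_rpow_of_exponent_ge h0 h hs1.le
        · exact h2.trans (Real.one_le_rpow h hs0.le)
      rw [Real.div_rpow (by linarith) hry.le] at key
      have hrp : 0 < r y ^ s := Real.rpow_pos_of_pos hry _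
      obtain ⟨m0, m1⟩ := hm y hy
      have : 0 ≤ 8 * L * (v - u) := by
        have : 0 ≤ v - u := by linarith
        positivity
      rw [← mul_sub]
      calc (F (y + ρ y) - F (y - ρ y)) * (ramp (z y) (r y) v - ramp (z y) (r y) u)
        ≤ (F (y + ρ y) - F (y - ρ y)) * ((v - u) ^ s / r y ^ s) := by gcongr
        _ ≤ (2 * L * (κ * r y ^ s)) * ((v - u) ^ s / r y ^ s) := by
            gcongr
            exact m1.trans (by gcongr; exact hrs y hy)
        _ = 2 * L * κ * (v - u) ^ s := by field_simp
        _ ≤ _ := by linarith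
    · intro y' hy' hne
      have hdis : Disjoint (Icc (y' - ρ y') (y' + ρ y')) (Icc (y - ρ y) (y + ρ y)) := hd hy' hy hne
      have hz' := abs_le.1 (hz y' hy')
      have h2 := hρ y' hy'
      have h3 := hrρ y' hy'
      rw [Set.disjoint_left] at hdis
      rw [← mul_sub]
      rcases le_total u (y' - ρ y') with h | h
      · have hv : v ≤ y' - ρ y' := by
          by_contra hcon
          push Not at hcon
          exact hdis (a := y' - ρ y') ⟨le_rfl, by linarith⟩ ⟨by linarith, by linarith⟩
        rw [ramp_zero _ _ v (hr _ hy') (by linarith), ramp_zero _ _ u (hr _ hy') (by linarith)]; simp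
      · have hv : y' + ρ y' < u := by
          by_contra hcon
          push Not at hcon
          exact hdis (a := u) ⟨h, by linarith⟩ ⟨by linarith, by linarith⟩
        rw [ramp_one _ _ v (hr _ hy') (by linarith), ramp_one _ _ u (hr _ hy') (by linarith)]; simp
  · push Not at hA
    set t' := t.filter (fun y => z y - r y ≤ v ∧ u ≤ z y + r y) with ht'
    have hbd : ∀ y ∈ t', max u (y - ρ y) + ρ y / 4 ≤ min v (y + ρ y) := by
      intro y hy'
      obtain ⟨hy, h5, h6⟩ := Finset.mem_filter.1 hy'
      have hz' := abs_le.1 (hz y hy)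
      have h2 := hρ y hy
      have h3 := hrρ y hy
      have h4 := hr y hy
      have h7 := hA y hy
      rw [← max_add_add_right, le_min_iff, max_le_iff, max_le_iff]
      by_cases h8 : y - ρ y ≤ u
      · have := h7 h8
        refine ⟨⟨?_, ?_⟩, ?_, ?_⟩ <;> linarith
      · refine ⟨⟨?_, ?_⟩, ?_, ?_⟩ <;> linarith
    have h1 : ∑ y ∈ t, ((F (y + ρ y) - F (y - ρ y)) * ramp (z y) (r y) v - (F (y + ρ y) - F (y - ρ y)) * ramp (z y) (r y) u)
        ≤ ∑ y ∈ t', (8 * L) * ((min v (y + ρ y)) - max u (y - ρ y)) := by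
      rw [ht', Finset.sum_filter]
      apply Finset.sum_le_sum
      intro y hy
      obtain ⟨m0, m1⟩ := hm y hy
      split_ifs with hc
      · have h4 := hbd y (Finset.mem_filter.2 ⟨hy, hc⟩)
        have h2 : ramp (z y) (r y) v - ramp (z y) (r y) u ≤ 1 := by
          linarith [ramp_le_one (z y) (r y) v, ramp_nonneg (z y) (r y) u]
        rw [← mul_sub]
        calc _ ≤ (F (y + ρ y) - F (y - ρ y)) * 1 := by gcongr
          _ ≤ (8 * L) * (ρ y / 4) := by linarith
          _ ≤ _ := by gcongr; linarith
      · rw [not_and_or] at hc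
        rcases hc with hc | hc
        · rw [ramp_zero _ _ v (hr y hy) (by linarith), ramp_zero _ _ u (hr y hy) (by linarith)]; simp
        · rw [ramp_one _ _ v (hr y hy) (by linarith), ramp_one _ _ u (hr y hy) (by linarith)]; simp
    have h2 : ∑ y ∈ t', ((min v (y + ρ y)) - max u (y - ρ y)) ≤ v - u := by
      apply sum_incr_le t' (fun y => max u (y - ρ y)) (fun y => min v (y + ρ y)) (fun x => x) monotone_id continuous_id
      · intro y hy; have := hρ y (Finset.mem_filter.1 hy).1; have := hbd y hy; linarith
      · intro y hy; exact le_max_left _ _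
      · intro y hy; exact min_le_left _ _
      · exact huv
      · intro a ha b hb hab
        refine (hd (Finset.mem_filter.1 ha).1 (Finset.mem_filter.1 hb).1 hab).mono ?_ ?_ <;>
        exact Icc_subset_Icc (le_max_right _ _) (min_le_right _ _)
    rw [← Finset.mul_sum] at h1
    have h3 : 0 ≤ 2 * L * κ * (v - u) ^ s := by positivity
    have h4 : 8 * L * ∑ y ∈ t', ((min v (y + ρ y)) - max u (y - ρ y)) ≤ 8 * L * (v - u) := by gcongr
    linarith

end core


lemma mtp_step (z r : ℕ → ℝ) (s : ℝ) (hs0 : 0 < s) (hs1 : s < 1)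
    (H : ∀ᵐ y ∂(volume : Measure ℝ), y ∈ Ioo (0:ℝ) 1 → ∀ κ > 0, ∀ N : ℕ, ∃ n ≥ N, ∃ ρ, 0 < ρ ∧ ρ < κ ∧ 0 < r n ∧
      |z n - y| ≤ ρ / 2 ∧ r n ≤ ρ / 4 ∧ ρ ≤ κ * (r n) ^ s)
    (F : ℝ → ℝ) (C C' ε : ℝ) (N : ℕ) (hC : 0 < C) (hCC : C < C') (hε : 0 < ε) (hF : Adm s C F) :
    ∃ F' : ℝ → ℝ, Adm s C' F' ∧ (∀ x, |F' x - F x| ≤ ε) ∧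
      ∃ S : Finset ℝ, ∀ x, (∀ n ≥ N, x ∈ Ioo (0:ℝ) 1 → r n ≤ |z n - x|) → F' x ∈ S := by
  classical
  obtain ⟨hmono, hF0, hF1, ⟨L, hL0, hL⟩, hHol⟩ := hF
  have hFc : Continuous F := by
    apply LipschitzWith.continuous (K := L.toNNReal)
    apply LipschitzWith.of_dist_le_mul
    intro x y
    rw [Real.dist_eq, Real.dist_eq, Real.coe_toNNReal _ hL0.le]
    rcases le_total x y with h | h
    · rw [abs_sub_comm, abs_sub_comm x, abs_of_nonneg (by linarith [hmono h]), abs_of_nonneg (by linarith)]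
      exact hL x y h
    · rw [abs_of_nonneg (by linarith [hmono h]), abs_of_nonneg (by linarith)]
      exact hL y x h
  obtain ⟨δ, hδ0, hδ⟩ : ∃ δ : ℝ, 0 < δ ∧ 8 * L * δ ^ (1 - s) = C / 2 := by
    refine ⟨(C / (16 * L)) ^ (1 / (1 - s)), by positivity, ?_⟩
    rw [← Real.rpow_mul (by positivity), one_div_mul_cancel (by linarith), Real.rpow_one]
    field_simp; norm_num
  have hδs : 0 < δ ^ s := by positivity
  obtain ⟨κ, hκ0, hκ1, hκ2, hκ3⟩ : ∃ κ : ℝ, 0 < κ ∧ 4 * κ * L ≤ C ∧ 4 * κ * L ≤ (C' - C) * δ ^ s ∧ 4 * κ * L ≤ ε / 2 := by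
    have h1 : 0 < (C' - C) * δ ^ s := mul_pos (by linarith) hδs
    refine ⟨min C (min ((C' - C) * δ ^ s) (ε / 2)) / (4 * L), ?_, ?_, ?_, ?_⟩
    · apply div_pos _ (by linarith)
      simp only [lt_min_iff]
      exact ⟨hC, h1, by linarith⟩
    all_goals
      have : 4 * (min C (min ((C' - C) * δ ^ s) (ε / 2)) / (4 * L)) * L = min C (min ((C' - C) * δ ^ s) (ε / 2)) := by
        field_simp
      rw [this]
    · exact min_le_left _ _
    · exact (min_le_right _ _).trans (min_le_left _ _)
    · exact (min_le_right _ _).trans (min_le_right _ _)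
  set η := ε / (2 * L) with hη
  have hη0 : 0 < η := by positivity
  have hLη : L * η = ε / 2 := by rw [hη]; field_simp
  -- covering
  set G : Set ℝ := {y | y ∈ Ioo (0:ℝ) 1 ∧ ∀ κ > 0, ∀ N : ℕ, ∃ n ≥ N, ∃ ρ, 0 < ρ ∧ ρ < κ ∧ 0 < r n ∧
      |z n - y| ≤ ρ / 2 ∧ r n ≤ ρ / 4 ∧ ρ ≤ κ * (r n) ^ s} with hG
  have hGnull : volume (Ioo (0:ℝ) 1 \ G) = 0 := by
    refine measure_mono_null ?_ (ae_iff.1 H)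
    intro y hy
    show ¬ _
    intro hcon
    exact hy.2 ⟨hy.1, hcon hy.1⟩
  let f : ℝ → Set ℝ := fun y => {ρ | ∃ n ≥ N, ρ < κ ∧ 0 < r n ∧
      |z n - y| ≤ ρ / 2 ∧ r n ≤ ρ / 4 ∧ ρ ≤ κ * (r n) ^ s}
  obtain ⟨B, ρ, hBc, hBG, hBρ, hBcov, hBd⟩ := Besicovitch.exists_disjoint_closedBall_covering_ae volume f G
    (by
      intro y hy δ' hδ'
      obtain ⟨n, hn, ρ, h1, h2, h3, h4, h5, h6⟩ := hy.2 (min κ δ') (lt_min hκ0 hδ') N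
      refine ⟨ρ, ⟨n, hn, h2.trans_le (min_le_left _ _), h3, h4, h5, h6.trans ?_⟩, h1, h2.trans_le (min_le_right _ _)⟩
      have : 0 < r n ^ s := by positivity
      gcongr
      exact min_le_left _ _)
    (fun y => min y (1 - y)) (by intro y hy; exact lt_min hy.1.1 (by linarith [hy.1.2]))
  have hcov' : volume (Ioo (0:ℝ) 1 \ ⋃ y ∈ B, Metric.closedBall y (ρ y)) = 0 := by
    refine measure_mono_null ?_ (measure_union_null hGnull hBcov)
    intro y hy
    by_cases h : y ∈ G
    · exact Or.inr ⟨h, hy.2⟩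
    · exact Or.inl ⟨hy.1, h⟩
  obtain ⟨t, htB, htsum⟩ := finite_select B ρ hBc (fun y hy => (hBρ y hy).2.1) hcov' hBd η hη0
  have hch : ∀ y : ℝ, ∃ n, y ∈ t → (n ≥ N ∧ ρ y < κ ∧ 0 < r n ∧
      |z n - y| ≤ ρ y / 2 ∧ r n ≤ ρ y / 4 ∧ ρ y ≤ κ * (r n) ^ s) := by
    intro y
    by_cases hy : y ∈ t
    · obtain ⟨n, hn⟩ := (hBρ y (htB hy)).1
      exact ⟨n, fun _ => hn⟩
    · exact ⟨0, fun h => absurd h hy⟩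
  choose n hn using hch
  set z' : ℝ → ℝ := fun y => z (n y) with hz'
  set r' : ℝ → ℝ := fun y => r (n y) with hr'
  have hρ : ∀ y ∈ t, 0 < ρ y ∧ ρ y < κ := fun y hy => ⟨(hBρ y (htB hy)).2.1, (hn y hy).2.1⟩
  have hr : ∀ y ∈ t, 0 < r' y := fun y hy => (hn y hy).2.2.1
  have hz : ∀ y ∈ t, |z' y - y| ≤ ρ y / 2 := fun y hy => (hn y hy).2.2.2.1
  have hrρ : ∀ y ∈ t, r' y ≤ ρ y / 4 := fun y hy => (hn y hy).2.2.2.2.1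
  have hrs : ∀ y ∈ t, ρ y ≤ κ * r' y ^ s := fun y hy => (hn y hy).2.2.2.2.2
  have hb : ∀ y ∈ t, 0 < y - ρ y ∧ y + ρ y < 1 := by
    intro y hy
    have := (hBρ y (htB hy)).2.2
    simp only [lt_min_iff] at this
    constructor <;> linarith
  have hd : (t : Set ℝ).PairwiseDisjoint fun y => Icc (y - ρ y) (y + ρ y) := by
    have := hBd.subset htB
    simpa only [Real.closedBall_eq_Icc] using this
  have hup := redis_upper t ρ z' r' κ L F hmono hFc hL hL0 hρ hr hz hrρ hκ0 hb hd
  have htot := redis_total t ρ z' r' κ η L F hmono hFc hL hL0 (hF0 0 le_rfl) hρ hr hz hrρ hb htsum hd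
  have hsm := redis_small t ρ z' r' s κ L F hs0 hs1 hmono hL hL0 hρ hr hz hrρ hκ0 hrs hd
  have hmono' := redis_mono t ρ z' r' F hmono (fun y hy => (hρ y hy).1) hr
  have hzero : ∀ x ≤ 0, redis t ρ z' r' F x = 0 := by
    intro x hx
    apply Finset.sum_eq_zero
    intro y hy
    have h1 := abs_le.1 (hz y hy)
    have h2 := hb y hy
    have h3 := hrρ y hy
    have h4 := hρ y hy
    rw [ramp_zero _ _ _ (hr y hy) (by linarith), mul_zero]
  have hone : ∀ x, 1 ≤ x → redis t ρ z' r' F x = redis t ρ z' r' F 1 := by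
    intro x hx
    apply Finset.sum_congr rfl
    intro y hy
    have h1 := abs_le.1 (hz y hy)
    have h2 := hb y hy
    have h3 := hrρ y hy
    have h4 := hρ y hy
    rw [ramp_one _ _ _ (hr y hy) (by linarith), ramp_one _ _ _ (hr y hy) (by linarith)]
  have hclose : ∀ x, |redis t ρ z' r' F x - F x| ≤ ε := by
    have h01 : ∀ x ∈ Icc (0:ℝ) 1, |redis t ρ z' r' F x - F x| ≤ ε := by
      intro x hx
      have h1 := hup 0 x hx.1
      have h2 := hup x 1 hx.2
      rw [hzero 0 le_rfl, hF0 0 le_rfl] at h1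
      rw [abs_le]
      constructor <;> linarith
    intro x
    rcases le_total x 0 with h | h
    · rw [hzero x h, hF0 x h]; simpa using hε.le
    rcases le_total x 1 with h' | h'
    · exact h01 x ⟨h, h'⟩
    · rw [hone x h', hF1 x h']; exact h01 1 (by norm_num)
  refine ⟨redis t ρ z' r' F, ⟨hmono', hzero, hone, ?_, ?_⟩, hclose, ?_⟩
  · refine ⟨(∑ y ∈ t, (F (y + ρ y) - F (y - ρ y)) / (2 * r' y)) + 1, ?_, ?_⟩
    · have : 0 ≤ ∑ y ∈ t, (F (y + ρ y) - F (y - ρ y)) / (2 * r' y) := by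
        apply Finset.sum_nonneg
        intro y hy
        have := hmono (show y - ρ y ≤ y + ρ y by linarith [hρ y hy])
        exact div_nonneg (by linarith) (by linarith [hr y hy])
      linarith
    · intro u v huv
      have : redis t ρ z' r' F v - redis t ρ z' r' F u ≤ (∑ y ∈ t, (F (y + ρ y) - F (y - ρ y)) / (2 * r' y)) * (v - u) := by
        unfold redis
        rw [← Finset.sum_sub_distrib, Finset.sum_mul]
        apply Finset.sum_le_sum
        intro y hy
        have h0 := hmono (show y - ρ y ≤ y + ρ y by linarith [hρ y hy])
        have := ramp_lip (z' y) (r' y) u v (hr y hy) huv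
        rw [← mul_sub]
        calc _ ≤ (F (y + ρ y) - F (y - ρ y)) * ((v - u) / (2 * r' y)) :=
              mul_le_mul_of_nonneg_left this (by linarith)
          _ = _ := by ring
      linarith
  · intro u v huv
    have hpow : 0 ≤ (v - u) ^ s := Real.rpow_nonneg (by linarith) _
    rcases le_total δ (v - u) with h | h
    · have h1 := hup u v huv
      have h2 := hHol u v huv
      have h3 : (C' - C) * δ ^ s ≤ (C' - C) * (v - u) ^ s := by
        have : 0 ≤ C' - C := by linarith
        gcongr
      linarith
    · have h1 := hsm u v huv
      have h2 : 8 * L * (v - u) ≤ C / 2 * (v - u) ^ s := by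
        rcases (show 0 ≤ v - u by linarith).eq_or_lt with h0 | h0
        · rw [← h0]; simp [hs0.ne']
        · have : v - u = (v - u) ^ (1 - s) * (v - u) ^ s := by
            rw [← Real.rpow_add h0]; simp
          rw [← hδ]
          calc 8 * L * (v - u) = 8 * L * (v - u) ^ (1 - s) * (v - u) ^ s := by
                rw [mul_assoc (8 * L) _ _, ← this]
            _ ≤ _ := by
                have : 0 ≤ 1 - s := by linarith
                gcongr
      have h3 : 2 * L * κ * (v - u) ^ s ≤ C / 2 * (v - u) ^ s := by
        gcongr; linarith
      have h4 : C * (v - u) ^ s ≤ C' * (v - u) ^ s := by gcongr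
      linarith
  · refine ⟨t.powerset.image (fun A => ∑ y ∈ A, (F (y + ρ y) - F (y - ρ y))), ?_⟩
    intro x hx
    rw [Finset.mem_image]
    refine ⟨t.filter (fun y => ramp (z' y) (r' y) x = 1), by simp, ?_⟩
    rw [Finset.sum_filter]
    apply Finset.sum_congr rfl
    intro y hy
    split_ifs with h
    · rw [h, mul_one]
    · have h1 := abs_le.1 (hz y hy)
      have h2 := hb y hy
      have h3 := hrρ y hy
      have h4 := hρ y hy
      suffices ramp (z' y) (r' y) x = 0 by rw [this, mul_zero]
      by_contra h5
      have h6 : x < z' y + r' y := by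
        by_contra hc; push Not at hc; exact h (ramp_one _ _ _ (hr y hy) hc)
      have h7 : z' y - r' y < x := by
        by_contra hc; push Not at hc; exact h5 (ramp_zero _ _ _ (hr y hy) hc)
      have := hx (n y) (hn y hy).1 ⟨by linarith, by linarith⟩
      have h8 : |z (n y) - x| < r (n y) := by
        rw [abs_lt]; constructor <;> simp only [hz', hr'] at h6 h7 <;> linarith
      linarith



lemma mtp_seq (z r : ℕ → ℝ) (s : ℝ) (hs0 : 0 < s) (hs1 : s < 1)
    (H : ∀ᵐ y ∂(volume : Measure ℝ), y ∈ Ioo (0:ℝ) 1 → ∀ κ > 0, ∀ N : ℕ, ∃ n ≥ N, ∃ ρ, 0 < ρ ∧ ρ < κ ∧ 0 < r n ∧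
      |z n - y| ≤ ρ / 2 ∧ r n ≤ ρ / 4 ∧ ρ ≤ κ * (r n) ^ s) :
    ∃ (F : ℕ → ℝ → ℝ) (ε : ℕ → ℝ), F 0 1 = 1 ∧ ε 0 = 1 / 4 ∧ (∀ k, 0 < ε k ∧ Adm s 2 (F k)) ∧
      ∀ k, (∀ x, |F (k+1) x - F k x| ≤ ε k) ∧ ε (k+1) ≤ ε k / 2 ∧
        ∃ S : Finset ℝ, (∀ x, (∀ n ≥ k, x ∈ Ioo (0:ℝ) 1 → r n ≤ |z n - x|) → F (k+1) x ∈ S) ∧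
          4 * ε (k+1) * S.card ≤ (1/2)^k / 8 := by
  let P : ℕ → Type := fun k => {p : (ℝ → ℝ) × ℝ // 0 < p.2 ∧ Adm s (2 - (1/2)^k) p.1}
  have base : ∃ p : P 0, p.1.1 1 = 1 ∧ p.1.2 = 1 / 4 := by
    have hmono : Monotone (fun x : ℝ => max 0 (min 1 x)) := by intro a b h; simp only; gcongr
    have hl : ∀ u v : ℝ, u ≤ v → max 0 (min 1 v) - max 0 (min 1 u) ≤ v - u := by
      intro u v h
      rcases le_total 1 u with h1 | h1 <;> rcases le_total 1 v with h2 | h2 <;>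
      rcases le_total 0 u with h3 | h3 <;> rcases le_total 0 v with h4 | h4 <;>
      simp [*] <;> linarith
    refine ⟨⟨(fun x => max 0 (min 1 x), 1/4), by norm_num, hmono, ?_, ?_, ⟨1, one_pos, ?_⟩, ?_⟩, by simp, rfl⟩
    · intro x hx; exact max_eq_left ((min_le_right _ _).trans hx)
    · intro x hx; simp [hx]
    · intro u v h; simpa using hl u v h
    · intro u v h
      have h1 := hl u v h
      have h2 : max 0 (min 1 v) - max 0 (min 1 u) ≤ 1 := by
        have : max 0 (min 1 v) ≤ 1 := max_le (by norm_num) (min_le_left _ _)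
        have : 0 ≤ max 0 (min 1 u) := le_max_left _ _
        linarith
      have e : (2 - (1/2:ℝ)^0) = 1 := by norm_num
      rw [e, one_mul]
      have h0 : 0 ≤ v - u := by linarith
      rcases le_total (v - u) 1 with h' | h'
      · calc _ ≤ (v - u) := h1
          _ = (v - u) ^ (1:ℝ) := by simp
          _ ≤ _ := by
              rcases h0.eq_or_lt with h0 | h0
              · rw [← h0]; simp [hs0.ne']
              · exact Real.rpow_le_rpow_of_exponent_ge h0 h' hs1.le
      · exact h2.trans (Real.one_le_rpow h' hs0.le)
  obtain ⟨p0, hp0, hp0'⟩ := base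
  have step : ∀ k (p : P k), ∃ q : P (k+1), (∀ x, |q.1.1 x - p.1.1 x| ≤ p.1.2) ∧ q.1.2 ≤ p.1.2 / 2 ∧
        ∃ S : Finset ℝ, (∀ x, (∀ n ≥ k, x ∈ Ioo (0:ℝ) 1 → r n ≤ |z n - x|) → q.1.1 x ∈ S) ∧
          4 * q.1.2 * S.card ≤ (1/2)^k / 8 := by
    rintro k ⟨⟨F, ε⟩, hε, hF⟩
    have hk : (1/2:ℝ)^k ≤ 1 := pow_le_one₀ (by norm_num) (by norm_num)
    have hk0 : 0 < (1/2:ℝ)^k := by positivity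
    obtain ⟨F', h1, h2, S, hS⟩ := mtp_step z r s hs0 hs1 H F (2 - (1/2)^k) (2 - (1/2)^(k+1)) ε k
      (by linarith) (by rw [pow_succ]; linarith) hε hF
    refine ⟨⟨(F', min (ε / 2) ((1/2)^k / 8 / (4 * (S.card + 1)))), ?_, h1⟩, h2, min_le_left _ _, S, hS, ?_⟩
    · apply lt_min (by simp at hε; linarith)
      positivity
    · calc 4 * min (ε / 2) ((1/2)^k / 8 / (4 * (S.card + 1))) * S.card
          ≤ 4 * ((1/2)^k / 8 / (4 * (S.card + 1))) * (S.card + 1) := by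
            gcongr
            · exact min_le_right _ _
            · linarith
        _ = _ := by field_simp
  choose nx hnx using step
  let sq : (k : ℕ) → P k := fun k => Nat.rec p0 (fun k p => nx k p) k
  refine ⟨fun k => (sq k).1.1, fun k => (sq k).1.2, hp0, hp0', ?_, fun k => hnx k (sq k)⟩
  intro k
  refine ⟨(sq k).2.1, ?_⟩
  obtain ⟨a, b, c, d, e⟩ := (sq k).2.2
  refine ⟨a, b, c, d, fun u v h => (e u v h).trans ?_⟩
  have hpow : 0 ≤ (v - u) ^ s := Real.rpow_nonneg (by linarith) _
  gcongr
  have : 0 < (1/2:ℝ)^k := by positivity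
  linarith

theorem mtp (z r : ℕ → ℝ) (s : ℝ) (hs0 : 0 < s) (hs1 : s < 1)
    (H : ∀ᵐ y ∂(volume : Measure ℝ), y ∈ Ioo (0:ℝ) 1 → ∀ κ > 0, ∀ N : ℕ, ∃ n ≥ N, ∃ ρ, 0 < ρ ∧ ρ < κ ∧ 0 < r n ∧
      |z n - y| ≤ ρ / 2 ∧ r n ≤ ρ / 4 ∧ ρ ≤ κ * (r n) ^ s) :
    ENNReal.ofReal s ≤ dimH {y | y ∈ Icc (0:ℝ) 1 ∧ ∃ᶠ n in atTop, |z n - y| < r n} := by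
  obtain ⟨F, ε, hF01, hε0, hadm, hstep⟩ := mtp_seq z r s hs0 hs1 H
  have tail : ∀ k m x, k ≤ m → |F m x - F k x| ≤ 2 * ε k - 2 * ε m := by
    intro k m x hkm
    induction m, hkm using Nat.le_induction with
    | base => simp
    | succ m hm ih =>
      have h1 := (hstep m).1 x
      have h2 := (hstep m).2.1
      have : |F (m+1) x - F k x| ≤ |F (m+1) x - F m x| + |F m x - F k x| := abs_sub_le _ _ _
      linarith
  have hgeo : ∀ k, ε k ≤ 1 / 4 * (1/2)^k := by
    intro k
    induction k with
    | zero => simp [hε0]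
    | succ k ih => have := (hstep k).2.1; rw [pow_succ]; linarith
  have hlim : ∀ x, ∃ l, Tendsto (fun k => F k x) atTop (𝓝 l) := by
    intro x
    apply cauchySeq_tendsto_of_complete
    apply cauchySeq_of_le_geometric (1/2) (1/4) (by norm_num)
    intro k
    rw [dist_comm, Real.dist_eq]
    exact ((hstep k).1 x).trans (hgeo k)
  choose G hG using hlim
  have hGF : ∀ k x, |G x - F k x| ≤ 2 * ε k := by
    intro k x
    have h1 : Tendsto (fun m => |F m x - F k x|) atTop (𝓝 |G x - F k x|) :=
      ((hG x).sub_const _).abs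
    refine le_of_tendsto h1 ?_
    filter_upwards [eventually_ge_atTop k] with m hm
    have := tail k m x hm
    linarith [(hadm m).1]
  have hGhol : ∀ u v, u ≤ v → |G v - G u| ≤ 2 * (v - u) ^ s := by
    intro u v h
    have h1 : Tendsto (fun m => |F m v - F m u|) atTop (𝓝 |G v - G u|) := ((hG v).sub (hG u)).abs
    refine le_of_tendsto' h1 fun m => ?_
    rw [abs_of_nonneg (by linarith [(hadm m).2.1 h])]
    exact (hadm m).2.2.2.2.2 u v h
  have hHW : HolderWith 2 s.toNNReal G := by
    intro u v
    rw [edist_dist, edist_dist, Real.coe_toNNReal _ hs0.le, ENNReal.ofReal_rpow_of_nonneg dist_nonneg hs0.le]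
    have : ((2 : NNReal) : ENNReal) = ENNReal.ofReal 2 := by simp
    rw [this, ← ENNReal.ofReal_mul (by norm_num)]
    apply ENNReal.ofReal_le_ofReal
    rw [Real.dist_eq, Real.dist_eq]
    rcases le_total u v with h | h
    · rw [abs_sub_comm, abs_sub_comm u, abs_of_nonneg (show 0 ≤ v - u by linarith)]; exact hGhol u v h
    · rw [abs_of_nonneg (show 0 ≤ u - v by linarith)]; exact hGhol v u h
  set V : ℕ → Set ℝ := fun k => {x | ∃ n ≥ k, x ∈ Ioo (0:ℝ) 1 ∧ |z n - x| < r n} with hV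
  set E : Set ℝ := {y | y ∈ Icc (0:ℝ) 1 ∧ ∃ᶠ n in atTop, |z n - y| < r n} with hE
  have hVE : ⋂ k, V k ⊆ E := by
    intro x hx
    rw [mem_iInter] at hx
    obtain ⟨_, _, h0, _⟩ := hx 0
    refine ⟨⟨h0.1.le, h0.2.le⟩, ?_⟩
    rw [frequently_atTop]
    intro a
    obtain ⟨n, hn, _, h⟩ := hx a
    exact ⟨n, hn, h⟩
  have hbad : ∀ k, volume (G '' (V k)ᶜ) ≤ ENNReal.ofReal ((1/2)^k / 8) := by
    intro k
    obtain ⟨S, hS, hcard⟩ := (hstep k).2.2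
    have hsub : G '' (V k)ᶜ ⊆ ⋃ a ∈ S, Icc (a - 2 * ε (k+1)) (a + 2 * ε (k+1)) := by
      rintro _ ⟨x, hx, rfl⟩
      have hm : F (k+1) x ∈ S := by
        apply hS
        intro n hn hx01
        by_contra hc
        push Not at hc
        exact hx ⟨n, hn, hx01, hc⟩
      simp only [mem_iUnion]
      refine ⟨_, hm, ?_⟩
      have := abs_le.1 (hGF (k+1) x)
      constructor <;> linarith
    calc _ ≤ volume (⋃ a ∈ S, Icc (a - 2 * ε (k+1)) (a + 2 * ε (k+1))) := measure_mono hsub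
      _ ≤ ∑ a ∈ S, volume (Icc (a - 2 * ε (k+1)) (a + 2 * ε (k+1))) := measure_biUnion_finset_le _ _
      _ = ∑ a ∈ S, ENNReal.ofReal (4 * ε (k+1)) := by
          apply Finset.sum_congr rfl
          intro a _
          rw [Real.volume_Icc]; congr 1; ring
      _ = ENNReal.ofReal (4 * ε (k+1) * S.card) := by
          rw [Finset.sum_const, nsmul_eq_mul, ENNReal.ofReal_mul (p := 4 * ε (k+1)) (by linarith [(hadm (k+1)).1]), mul_comm,
            ENNReal.ofReal_natCast]
      _ ≤ _ := ENNReal.ofReal_le_ofReal hcard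
  have hGc : Continuous G := hHW.continuous (by simpa using hs0)
  have hG0 : G 0 = 0 := by
    refine tendsto_nhds_unique (hG 0) ?_
    have : (fun k => F k 0) = fun _ => 0 := by ext k; exact (hadm k).2.2.1 0 le_rfl
    rw [this]; exact tendsto_const_nhds
  have hG1 : 1/2 ≤ G 1 := by
    have := abs_le.1 (hGF 0 1)
    rw [hF01, hε0] at this
    linarith
  have hrange : Icc (0:ℝ) (1/2) ⊆ G '' (⋂ k, V k) ∪ ⋃ k, G '' (V k)ᶜ := by
    intro y hy
    have : y ∈ G '' Icc 0 1 := by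
      apply intermediate_value_Icc (by norm_num) hGc.continuousOn
      rw [hG0]; exact ⟨hy.1, hy.2.trans hG1⟩
    obtain ⟨x, _, rfl⟩ := this
    by_cases h : x ∈ ⋂ k, V k
    · exact Or.inl ⟨x, h, rfl⟩
    · rw [mem_iInter] at h
      push Not at h
      obtain ⟨k, hk⟩ := h
      exact Or.inr (mem_iUnion.2 ⟨k, x, hk, rfl⟩)
  have hpos : volume (G '' E) ≠ 0 := by
    intro h0
    have h1 : volume (G '' (⋂ k, V k)) = 0 := measure_mono_null (image_mono hVE) h0
    have h2 := (measure_mono hrange (μ := volume)).trans (measure_union_le _ _)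
    rw [h1, zero_add] at h2
    have h3 : volume (⋃ k, G '' (V k)ᶜ) ≤ ENNReal.ofReal (1/4) := by
      refine (measure_iUnion_le _).trans ((ENNReal.tsum_le_tsum hbad).trans ?_)
      have hs : HasSum (fun k : ℕ => (1/2:ℝ)^k / 8) (1/4) := by
        have := hasSum_geometric_two.div_const (8:ℝ)
        norm_num at this ⊢
        exact this
      rw [← ENNReal.ofReal_tsum_of_nonneg (fun k => by positivity) hs.summable, hs.tsum_eq]
    have h4 := h2.trans h3
    rw [Real.volume_Icc, ENNReal.ofReal_le_ofReal_iff (by norm_num)] at h4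
    norm_num at h4
  have h1 : (1 : ENNReal) ≤ dimH (G '' E) := by
    have := le_dimH_of_hausdorffMeasure_ne_zero (s := G '' E) (d := 1) (by
      rw [NNReal.coe_one, hausdorffMeasure_real]; exact hpos)
    simpa using this
  have h2 := hHW.dimH_image_le (by simpa using hs0) E
  have h3 := h1.trans h2
  have hs' : (s.toNNReal : ENNReal) = ENNReal.ofReal s := rfl
  rw [ENNReal.le_div_iff_mul_le (Or.inl (by simpa using hs0)) (Or.inl (by simp)), one_mul, hs'] at h3
  exact h3

theorem upper_dim (T : ℝ → ℝ) (x α : ℝ) (hα : 1 ≤ α) (r : ℕ → ℝ) (hr : ∀ j : ℕ, r j = (j : ℝ) ^ (-α)) :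
    dimH {y | y ∈ Icc (0:ℝ) 1 ∧ ∃ᶠ n in atTop, |T^[n] x - y| < r n} ≤ ENNReal.ofReal (1 / α) := by
  have hα0 : 0 < α := by linarith
  apply le_of_forall_gt_imp_ge_of_dense
  intro c hc
  obtain ⟨d, hd1, hd2⟩ := ENNReal.lt_iff_exists_nnreal_btwn.1 hc
  refine le_trans ?_ hd2.le
  apply dimH_le_of_hausdorffMeasure_ne_top
  have hd : 1 / α < d := by
    have : ENNReal.ofReal (1/α) < ENNReal.ofReal d := by simpa using hd1
    exact (ENNReal.ofReal_lt_ofReal_iff_of_nonneg (by positivity)).1 this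
  have hd0 : 0 < (d:ℝ) := lt_trans (by positivity) hd
  have hsum : Summable (fun n : ℕ => (2 * r n) ^ (d:ℝ)) := by
    have : (fun n : ℕ => (2 * r n) ^ (d:ℝ)) = fun n : ℕ => 2 ^ (d:ℝ) * (n:ℝ) ^ (-(α * d)) := by
      ext n
      rw [hr, Real.mul_rpow (by norm_num) (by positivity), ← Real.rpow_mul (by positivity)]
      ring_nf
    rw [this]
    apply Summable.mul_left
    rw [Real.summable_nat_rpow]
    rw [div_lt_iff₀ hα0] at hd
    linarith [mul_comm α (d:ℝ)]
  have hrn : ∀ n, 0 ≤ r n := fun n => by rw [hr]; positivity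
  have h := Measure.hausdorffMeasure_le_liminf_tsum (d:ℝ) {y | y ∈ Icc (0:ℝ) 1 ∧ ∃ᶠ n in atTop, |T^[n] x - y| < r n}
    (l := atTop) (fun N : ℕ => ENNReal.ofReal (2 * ((N:ℝ)) ^ (-α)))
    (by
      rw [← ENNReal.ofReal_zero]
      apply ENNReal.tendsto_ofReal
      have := (tendsto_rpow_neg_atTop hα0).comp tendsto_natCast_atTop_atTop (α := ℕ)
      simpa using this.const_mul 2)
    (fun N (n : ℕ) => Metric.ball (T^[n + N] x) (r (n + N)))
    (by
      filter_upwards [eventually_gt_atTop 0] with N hN n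
      rw [Real.ball_eq_Ioo, Real.ediam_Ioo]
      apply ENNReal.ofReal_le_ofReal
      rw [hr]
      have : ((n + N : ℕ):ℝ) ^ (-α) ≤ (N:ℝ) ^ (-α) := by
        apply Real.rpow_le_rpow_of_nonpos (by exact_mod_cast hN) (by push_cast; linarith [Nat.cast_nonneg (α := ℝ) n]) (by linarith)
      linarith)
    (by
      refine Eventually.of_forall fun N y hy => ?_
      obtain ⟨n, hn, h⟩ := frequently_atTop.1 hy.2 N
      rw [mem_iUnion]
      refine ⟨n - N, ?_⟩
      rw [Nat.sub_add_cancel hn, Metric.mem_ball, dist_comm]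
      exact h)
  refine ne_top_of_le_ne_top ?_ h
  have hfin : ∑' n : ℕ, ENNReal.ofReal ((2 * r n) ^ (d:ℝ)) ≠ ⊤ := by
    rw [← ENNReal.ofReal_tsum_of_nonneg (fun n => Real.rpow_nonneg (by linarith [hrn n]) _) hsum]
    exact ENNReal.ofReal_ne_top
  refine ne_top_of_le_ne_top hfin ?_
  refine liminf_le_of_le (by isBoundedDefault) ?_
  intro b hb
  obtain ⟨N, hN⟩ := hb.exists
  refine hN.trans ?_
  calc ∑' n : ℕ, Metric.ediam (Metric.ball (T^[n + N] x) (r (n + N))) ^ (d:ℝ)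
      = ∑' n : ℕ, ENNReal.ofReal ((2 * r (n + N)) ^ (d:ℝ)) := by
        congr 1; ext n
        rw [Real.ball_eq_Ioo, Real.ediam_Ioo, ENNReal.ofReal_rpow_of_nonneg (by linarith [hrn (n+N)]) hd0.le]
        congr 2; ring
    _ ≤ _ := ENNReal.tsum_comp_le_tsum_of_injective (add_left_injective N) (fun n => ENNReal.ofReal ((2 * r n) ^ (d:ℝ)))


lemma rpow_tangent (β : ℝ) (hβ : 1 < β) (a x : ℝ) (ha : 0 ≤ a) (hx : 0 ≤ x) :
    a ^ β + β * a ^ (β - 1) * (x - a) ≤ x ^ β := by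
  rcases ha.eq_or_lt with rfl | ha
  · rw [Real.zero_rpow (by linarith), Real.zero_rpow (by linarith)]
    simp; positivity
  · have h := one_add_mul_self_le_rpow_one_add (s := (x - a) / a) (p := β)
      (by rw [le_div_iff₀ ha]; linarith) hβ.le
    have e : 1 + (x - a) / a = x / a := by field_simp; ring
    rw [e, Real.div_rpow hx ha.le] at h
    have hp : 0 < a ^ β := by positivity
    rw [le_div_iff₀ hp] at h
    rw [Real.rpow_sub_one ha.ne']
    calc _ = (1 + β * ((x - a) / a)) * a ^ β := by ring
      _ ≤ _ := h

/-- left branch -/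
noncomputable def f0 (β y : ℝ) : ℝ := y + 2 ^ (β - 1) * y ^ β
/-- its derivative -/
noncomputable def d0 (β y : ℝ) : ℝ := 1 + β * (2 ^ (β - 1) * y ^ (β - 1))

lemma d0_ge (β y : ℝ) (hβ : 1 < β) (hy : 0 ≤ y) : 1 ≤ d0 β y := by
  unfold d0
  have : 0 ≤ β * (2 ^ (β - 1) * y ^ (β - 1)) := by positivity
  linarith

lemma f0_tangent (β : ℝ) (hβ : 1 < β) (a x : ℝ) (ha : 0 ≤ a) (hx : 0 ≤ x) :
    f0 β a + d0 β a * (x - a) ≤ f0 β x := by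
  have h := rpow_tangent β hβ a x ha hx
  have h2 : (0:ℝ) < 2 ^ (β - 1) := by positivity
  unfold f0 d0
  nlinarith

lemma f0_zero (β : ℝ) (hβ : 1 < β) : f0 β 0 = 0 := by
  unfold f0; rw [Real.zero_rpow (by linarith)]; simp
lemma f0_half (β : ℝ) : f0 β (1/2) = 1 := by
  unfold f0
  rw [Real.div_rpow (by norm_num) (by norm_num), Real.one_rpow, Real.rpow_sub_one (by norm_num)]
  have : (0:ℝ) < 2 ^ β := by positivity
  field_simp; norm_num

lemma f0_exists (β : ℝ) (hβ : 1 < β) (x : ℝ) (hx : x ∈ Icc (0:ℝ) 1) :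
    ∃ y ∈ Icc (0:ℝ) (1/2), f0 β y = x := by
  have hc : Continuous (f0 β) := by
    unfold f0
    exact continuous_id.add (continuous_const.mul (Real.continuous_rpow_const (by linarith)))
  have := intermediate_value_Icc (show (0:ℝ) ≤ 1/2 by norm_num) hc.continuousOn
  rw [f0_zero β hβ, f0_half] at this
  exact this hx

lemma f0_lt_iff (β : ℝ) (hβ : 1 < β) (u v : ℝ) (hu : 0 ≤ u) (hv : 0 ≤ v) (h : f0 β u < f0 β v) : u < v := by
  by_contra hc
  push Not at hc
  have h1 := f0_tangent β hβ v u hv hu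
  have h2 := d0_ge β v hβ hv
  nlinarith

open Classical in
/-- inverse of the left branch -/
noncomputable def g0 (β x : ℝ) : ℝ :=
  if h : 1 < β ∧ x ∈ Icc (0:ℝ) 1 then (f0_exists β h.1 x h.2).choose else 0

lemma g0_spec (β : ℝ) (hβ : 1 < β) (x : ℝ) (hx : x ∈ Icc (0:ℝ) 1) :
    g0 β x ∈ Icc (0:ℝ) (1/2) ∧ f0 β (g0 β x) = x := by
  unfold g0
  rw [dif_pos ⟨hβ, hx⟩]
  exact (f0_exists β hβ x hx).choose_spec

/-- inverse branches -/
noncomputable def gB (β : ℝ) (i : Bool) (x : ℝ) : ℝ := if i then (x + 1) / 2 else g0 β x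
/-- derivatives of inverse branches -/
noncomputable def dB (β : ℝ) (i : Bool) (x : ℝ) : ℝ := if i then 1 / 2 else 1 / d0 β (g0 β x)

lemma gB_mem (β : ℝ) (hβ : 1 < β) (i : Bool) (x : ℝ) (hx : x ∈ Icc (0:ℝ) 1) : gB β i x ∈ Icc (0:ℝ) 1 := by
  cases i
  · have := (g0_spec β hβ x hx).1
    simp only [gB]
    exact ⟨this.1, this.2.trans (by norm_num)⟩
  · simp only [gB, if_true]; constructor <;> linarith [hx.1, hx.2]

lemma dB_pos (β : ℝ) (hβ : 1 < β) (i : Bool) (x : ℝ) (hx : x ∈ Icc (0:ℝ) 1) : 0 < dB β i x := by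
  cases i
  · have := d0_ge β _ hβ (g0_spec β hβ x hx).1.1
    simp only [dB]; simp; linarith
  · simp [dB]

lemma dB_le (β : ℝ) (hβ : 1 < β) (i : Bool) (x : ℝ) (hx : x ∈ Icc (0:ℝ) 1) :
    dB β i x ≤ if i then 1 / 2 else 1 := by
  cases i
  · have := d0_ge β _ hβ (g0_spec β hβ x hx).1.1
    simp only [dB]; simp only [Bool.false_eq_true, if_false]
    rw [div_le_one (by linarith)]; exact this
  · simp [dB]

lemma gB_lo (β : ℝ) (hβ : 1 < β) (i : Bool) (u v : ℝ) (hu : u ∈ Icc (0:ℝ) 1) (hv : v ∈ Icc (0:ℝ) 1) :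
    dB β i v * (v - u) ≤ gB β i v - gB β i u := by
  cases i
  · obtain ⟨hu1, hu2⟩ := g0_spec β hβ u hu
    obtain ⟨hv1, hv2⟩ := g0_spec β hβ v hv
    have h := f0_tangent β hβ _ _ hv1.1 hu1.1
    rw [hu2, hv2] at h
    have := d0_ge β _ hβ hv1.1
    simp only [gB, dB, Bool.false_eq_true, if_false]
    rw [one_div, inv_mul_le_iff₀ (by linarith)]
    linarith
  · simp only [gB, dB, if_true]; linarith

lemma gB_hi (β : ℝ) (hβ : 1 < β) (i : Bool) (u v : ℝ) (hu : u ∈ Icc (0:ℝ) 1) (hv : v ∈ Icc (0:ℝ) 1) :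
    gB β i v - gB β i u ≤ dB β i u * (v - u) := by
  have := gB_lo β hβ i v u hv hu
  linarith

lemma gB_mono (β : ℝ) (hβ : 1 < β) (i : Bool) (u v : ℝ) (hu : u ∈ Icc (0:ℝ) 1) (hv : v ∈ Icc (0:ℝ) 1) (huv : u ≤ v) :
    gB β i u ≤ gB β i v := by
  have h1 := gB_lo β hβ i u v hu hv
  have h2 := dB_pos β hβ i v hv
  nlinarith

lemma ratio_aux (β w1 w2 : ℝ) (h1 : 1 < β) (h2 : β < 2) (hw1 : 0 ≤ w1) (hw : w1 ≤ w2) :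
    (1 + w1) ^ 2 * (1 + β * w2) ≤ (1 + w2) ^ 2 * (1 + β * w1) := by
  have : 0 ≤ (w2 - w1) * (2 - β + w1 + w2 + β * (w1 * w2)) := by
    apply mul_nonneg (by linarith)
    have : 0 ≤ β * (w1 * w2) := by
      have : 0 ≤ w2 := by linarith
      positivity
    linarith
  nlinarith

lemma gB_sq (β : ℝ) (hβ : 1 < β) (hβ2 : β < 2) (i : Bool) (u v : ℝ) (hu : 0 < u) (huv : u ≤ v) (hv : v ≤ 1) :
    0 < gB β i u ∧ u ^ 2 * dB β i u * (gB β i v) ^ 2 ≤ v ^ 2 * dB β i v * (gB β i u) ^ 2 := by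
  have hui : u ∈ Icc (0:ℝ) 1 := ⟨hu.le, huv.trans hv⟩
  have hvi : v ∈ Icc (0:ℝ) 1 := ⟨by linarith, hv⟩
  cases i
  · have hm := gB_mono β hβ false u v hui hvi huv
    obtain ⟨hu1, hu2⟩ := g0_spec β hβ u hui
    obtain ⟨hv1, hv2⟩ := g0_spec β hβ v hvi
    simp only [gB, dB, Bool.false_eq_true, if_false] at *
    set p := g0 β u
    set q := g0 β v
    have hp : 0 < p := by
      apply f0_lt_iff β hβ _ _ le_rfl hu1.1
      rw [f0_zero β hβ, hu2]; exact hu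
    have hq : 0 < q := hp.trans_le hm
    refine ⟨hp, ?_⟩
    have e : ∀ y, 0 < y → f0 β y = y * (1 + 2 ^ (β - 1) * y ^ (β - 1)) := by
      intro y hy
      unfold f0
      rw [Real.rpow_sub_one hy.ne' β]; field_simp
    have hdp := d0_ge β p hβ hp.le
    have hdq := d0_ge β q hβ hq.le
    have hr := ratio_aux β (2 ^ (β - 1) * p ^ (β - 1)) (2 ^ (β - 1) * q ^ (β - 1)) hβ hβ2 (by positivity)
      (by have : 0 ≤ β - 1 := by linarith
          gcongr)
    have hr' : (1 + 2 ^ (β - 1) * p ^ (β - 1)) ^ 2 * d0 β q ≤ (1 + 2 ^ (β - 1) * q ^ (β - 1)) ^ 2 * d0 β p := hr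
    have eu : u = p * (1 + 2 ^ (β - 1) * p ^ (β - 1)) := by rw [← e p hp, hu2]
    have ev : v = q * (1 + 2 ^ (β - 1) * q ^ (β - 1)) := by rw [← e q hq, hv2]
    generalize (1 + 2 ^ (β - 1) * p ^ (β - 1)) = P at *
    generalize (1 + 2 ^ (β - 1) * q ^ (β - 1)) = Q at *
    rw [eu, ev]
    rw [mul_one_div, mul_one_div, div_mul_eq_mul_div, div_mul_eq_mul_div, div_le_div_iff₀ (by linarith) (by linarith)]
    have : 0 ≤ p ^ 2 * q ^ 2 := by positivity
    calc (p * P) ^ 2 * q ^ 2 * d0 β q = (p ^ 2 * q ^ 2) * (P ^ 2 * d0 β q) := by ring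
      _ ≤ (p ^ 2 * q ^ 2) * (Q ^ 2 * d0 β p) := by gcongr
      _ = _ := by ring
  · simp only [gB, dB, if_true]
    refine ⟨by linarith, ?_⟩
    have : u * ((v + 1)) ≤ v * ((u + 1)) := by nlinarith
    have h2 : (u * (v + 1)) ^ 2 ≤ (v * (u + 1)) ^ 2 := by
      apply pow_le_pow_left₀ (by nlinarith) this
    nlinarith

/-- composed inverse branches -/
noncomputable def hW (β : ℝ) : List Bool → ℝ → ℝ
  | [], x => x
  | i :: w, x => hW β w (gB β i x)
/-- their derivatives -/
noncomputable def dW (β : ℝ) : List Bool → ℝ → ℝ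
  | [], _ => 1
  | i :: w, x => dW β w (gB β i x) * dB β i x

lemma hW_mem (β : ℝ) (hβ : 1 < β) (w : List Bool) : ∀ x ∈ Icc (0:ℝ) 1, hW β w x ∈ Icc (0:ℝ) 1 := by
  induction w with
  | nil => intro x hx; exact hx
  | cons i w ih => intro x hx; exact ih _ (gB_mem β hβ i x hx)

lemma dW_pos (β : ℝ) (hβ : 1 < β) (w : List Bool) : ∀ x ∈ Icc (0:ℝ) 1, 0 < dW β w x := by
  induction w with
  | nil => intro x hx; exact one_pos
  | cons i w ih => intro x hx; exact mul_pos (ih _ (gB_mem β hβ i x hx)) (dB_pos β hβ i x hx)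

lemma dW_le (β : ℝ) (hβ : 1 < β) (w : List Bool) : ∀ x ∈ Icc (0:ℝ) 1, dW β w x ≤ (1/2)^(w.count true) := by
  induction w with
  | nil => intro x hx; simp [dW]
  | cons i w ih =>
    intro x hx
    have h1 := ih _ (gB_mem β hβ i x hx)
    have h2 := dB_le β hβ i x hx
    have h3 := dB_pos β hβ i x hx
    simp only [dW]
    calc dW β w (gB β i x) * dB β i x ≤ (1/2:ℝ)^(w.count true) * (if i then 1 / 2 else 1) := by gcongr
      _ = (1/2:ℝ)^((i :: w).count true) := by cases i <;> simp [pow_succ]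

lemma hW_lo (β : ℝ) (hβ : 1 < β) (w : List Bool) : ∀ u v, u ∈ Icc (0:ℝ) 1 → v ∈ Icc (0:ℝ) 1 →
    dW β w v * (v - u) ≤ hW β w v - hW β w u := by
  induction w with
  | nil => intro u v hu hv; simp [dW, hW]
  | cons i w ih =>
    intro u v hu hv
    have h1 := ih _ _ (gB_mem β hβ i u hu) (gB_mem β hβ i v hv)
    have h2 := gB_lo β hβ i u v hu hv
    have h3 := dW_pos β hβ w _ (gB_mem β hβ i v hv)
    simp only [dW, hW]
    nlinarith

lemma hW_hi (β : ℝ) (hβ : 1 < β) (w : List Bool) (u v : ℝ) (hu : u ∈ Icc (0:ℝ) 1) (hv : v ∈ Icc (0:ℝ) 1) :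
    hW β w v - hW β w u ≤ dW β w u * (v - u) := by
  have := hW_lo β hβ w v u hv hu
  linarith

lemma hW_mono (β : ℝ) (hβ : 1 < β) (w : List Bool) (u v : ℝ) (hu : u ∈ Icc (0:ℝ) 1) (hv : v ∈ Icc (0:ℝ) 1) (huv : u ≤ v) :
    hW β w u ≤ hW β w v := by
  have h1 := hW_lo β hβ w u v hu hv
  have h2 := dW_pos β hβ w v hv
  nlinarith

lemma dW_anti (β : ℝ) (hβ : 1 < β) (w : List Bool) (u v : ℝ) (hu : u ∈ Icc (0:ℝ) 1) (hv : v ∈ Icc (0:ℝ) 1) (huv : u ≤ v) :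
    dW β w v ≤ dW β w u := by
  rcases huv.eq_or_lt with rfl | h
  · exact le_rfl
  · have h1 := hW_lo β hβ w u v hu hv
    have h2 := hW_hi β hβ w u v hu hv
    have h3 := h1.trans h2
    exact le_of_mul_le_mul_right h3 (by linarith)

lemma dW_sq (β : ℝ) (hβ : 1 < β) (hβ2 : β < 2) (w : List Bool) : ∀ u v, 0 < u → u ≤ v → v ≤ 1 →
    u ^ 2 * dW β w u ≤ v ^ 2 * dW β w v := by
  induction w with
  | nil => intro u v hu huv hv; simp only [dW]; nlinarith
  | cons i w ih =>
    intro u v hu huv hv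
    have hui : u ∈ Icc (0:ℝ) 1 := ⟨hu.le, huv.trans hv⟩
    have hvi : v ∈ Icc (0:ℝ) 1 := ⟨by linarith, hv⟩
    obtain ⟨hp, hs⟩ := gB_sq β hβ hβ2 i u v hu huv hv
    have hm := gB_mono β hβ i u v hui hvi huv
    have h1 := ih _ _ hp hm (gB_mem β hβ i v hvi).2
    have hq : 0 < gB β i v := hp.trans_le hm
    have d1 := dW_pos β hβ w _ (gB_mem β hβ i u hui)
    have d2 := dW_pos β hβ w _ (gB_mem β hβ i v hvi)
    have d3 := dB_pos β hβ i u hui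
    have d4 := dB_pos β hβ i v hvi
    simp only [dW]
    generalize gB β i u = p at *
    generalize gB β i v = q at *
    have hpq : 0 < p ^ 2 * q ^ 2 := by positivity
    refine le_of_mul_le_mul_left ?_ hpq
    calc p ^ 2 * q ^ 2 * (u ^ 2 * (dW β w p * dB β i u)) = (p ^ 2 * dW β w p) * (u ^ 2 * dB β i u * q ^ 2) := by ring
      _ ≤ (q ^ 2 * dW β w q) * (v ^ 2 * dB β i v * p ^ 2) := by gcongr
      _ = _ := by ring

lemma dW_dist (β : ℝ) (hβ : 1 < β) (hβ2 : β < 2) (w : List Bool) : dW β w (1/2) ≤ 4 * dW β w 1 := by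
  have := dW_sq β hβ hβ2 w (1/2) 1 (by norm_num) (by norm_num) le_rfl
  linarith

lemma hW_append (β : ℝ) (w : List Bool) (i : Bool) : ∀ x, hW β (w ++ [i]) x = gB β i (hW β w x) := by
  induction w with
  | nil => intro x; rfl
  | cons j w ih => intro x; exact ih _


lemma T_gB (β : ℝ) (hβ : 1 < β) (i : Bool) (x : ℝ) (hx : x ∈ Ico (0:ℝ) 1) :
    MannevillePomeau β (gB β i x) = x ∧ gB β i x ∈ Ico (0:ℝ) 1 ∧ decide (1/2 ≤ gB β i x) = i := by
  cases i
  · obtain ⟨h1, h2⟩ := g0_spec β hβ x ⟨hx.1, hx.2.le⟩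
    have h3 : g0 β x < 1/2 := by
      apply f0_lt_iff β hβ _ _ h1.1 (by norm_num)
      rw [h2, f0_half]; exact hx.2
    simp only [gB, Bool.false_eq_true, if_false]
    refine ⟨?_, ⟨h1.1, by linarith⟩, by simpa using h3⟩
    unfold MannevillePomeau
    rw [if_pos h3]; exact h2
  · simp only [gB, if_true]
    have : ¬ ((x + 1) / 2 < 1 / 2) := by linarith [hx.1]
    refine ⟨?_, ⟨by linarith [hx.1], by linarith [hx.2]⟩, by simp; linarith [hx.1]⟩
    unfold MannevillePomeau
    rw [if_neg this]; ring

lemma gB_T (β : ℝ) (hβ : 1 < β) (z : ℝ) (hz : z ∈ Ico (0:ℝ) 1) :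
    gB β (decide (1/2 ≤ z)) (MannevillePomeau β z) = z ∧ MannevillePomeau β z ∈ Ico (0:ℝ) 1 := by
  by_cases h : 1/2 ≤ z
  · have h' : ¬ z < 1/2 := not_lt.2 h
    simp only [h, decide_true, gB, if_true, MannevillePomeau, h', if_false]
    refine ⟨by ring, by linarith, by linarith [hz.2]⟩
  · have h' : z < 1/2 := not_le.1 h
    have e : MannevillePomeau β z = f0 β z := by simp only [MannevillePomeau, h', if_true]; rfl
    have hm : f0 β z ∈ Ico (0:ℝ) 1 := by
      have h1 := f0_tangent β hβ 0 z le_rfl hz.1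
      have h2 := f0_tangent β hβ z (1/2) hz.1 (by norm_num)
      have h3 := d0_ge β 0 hβ le_rfl
      have h4 := d0_ge β z hβ hz.1
      rw [f0_zero β hβ] at h1
      rw [f0_half] at h2
      constructor <;> nlinarith [hz.1]
    rw [e]
    refine ⟨?_, hm⟩
    simp only [h, decide_false, gB, Bool.false_eq_true, if_false]
    obtain ⟨h1, h2⟩ := g0_spec β hβ (f0 β z) ⟨hm.1, hm.2.le⟩
    rcases lt_trichotomy (g0 β (f0 β z)) z with h3 | h3 | h3
    · have t1 := f0_tangent β hβ _ z h1.1 hz.1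
      have t2 := d0_ge β _ hβ h1.1
      nlinarith
    · exact h3
    · have t1 := f0_tangent β hβ z _ hz.1 h1.1
      have t2 := d0_ge β _ hβ hz.1
      nlinarith

lemma T_iter_mem (β : ℝ) (hβ : 1 < β) (k : ℕ) : ∀ z ∈ Ico (0:ℝ) 1, (MannevillePomeau β)^[k] z ∈ Ico (0:ℝ) 1 := by
  induction k with
  | zero => intro z hz; exact hz
  | succ k ih => intro z hz; rw [Function.iterate_succ_apply]; exact ih _ (gB_T β hβ z hz).2

lemma T_meas (β : ℝ) : Measurable (MannevillePomeau β) := by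
  unfold MannevillePomeau
  refine Measurable.ite measurableSet_Iio ?_ ?_ <;> fun_prop

lemma T_iter_meas (β : ℝ) (k : ℕ) : Measurable ((MannevillePomeau β)^[k]) := (T_meas β).iterate k

lemma hW_spec (β : ℝ) (hβ : 1 < β) (w : List Bool) : ∀ x ∈ Ico (0:ℝ) 1,
    hW β w x ∈ Ico (0:ℝ) 1 ∧ (MannevillePomeau β)^[w.length] (hW β w x) = x := by
  induction w with
  | nil => intro x hx; exact ⟨hx, rfl⟩
  | cons i w ih =>
    intro x hx
    obtain ⟨h1, h2, h3⟩ := T_gB β hβ i x hx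
    obtain ⟨h4, h5⟩ := ih _ h2
    refine ⟨h4, ?_⟩
    rw [List.length_cons, Function.iterate_succ_apply']
    simp only [hW]
    rw [h5, h1]

/-- itinerary, most recent symbol first -/
noncomputable def code (β : ℝ) : ℕ → ℝ → List Bool
  | 0, _ => []
  | k + 1, z => decide (1/2 ≤ (MannevillePomeau β)^[k] z) :: code β k z

lemma code_length (β : ℝ) (k : ℕ) (z : ℝ) : (code β k z).length = k := by
  induction k with
  | zero => rfl
  | succ k ih => simp [code, ih]

lemma hW_code (β : ℝ) (hβ : 1 < β) (k : ℕ) (z : ℝ) (hz : z ∈ Ico (0:ℝ) 1) :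
    hW β (code β k z) ((MannevillePomeau β)^[k] z) = z := by
  induction k with
  | zero => rfl
  | succ k ih =>
    simp only [code, hW]
    rw [Function.iterate_succ_apply', (gB_T β hβ _ (T_iter_mem β hβ k z hz)).1, ih]

lemma code_hW (β : ℝ) (hβ : 1 < β) (w : List Bool) : ∀ y ∈ Ico (0:ℝ) 1, code β w.length (hW β w y) = w := by
  induction w with
  | nil => intro y hy; rfl
  | cons i w ih =>
    intro y hy
    obtain ⟨h1, h2, h3⟩ := T_gB β hβ i y hy
    simp only [List.length_cons, code, hW]
    rw [ih _ h2, (hW_spec β hβ w _ h2).2, h3]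

lemma code_meas (β : ℝ) (k : ℕ) : ∀ w, MeasurableSet {z | code β k z = w} := by
  induction k with
  | zero => intro w; by_cases h : [] = w <;> simp [code, h]
  | succ k ih =>
    intro w
    cases w with
    | nil => simp [code]
    | cons i w =>
      have hm : MeasurableSet {z | 1/2 ≤ (MannevillePomeau β)^[k] z} := measurableSet_le measurable_const (T_iter_meas β k)
      have : {z | code β (k+1) z = i :: w} = {z | decide (1/2 ≤ (MannevillePomeau β)^[k] z) = i} ∩ {z | code β k z = w} := by
        ext z; simp [code]
      rw [this]
      refine MeasurableSet.inter ?_ (ih w)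
      cases i
      · convert hm.compl using 1
        ext z; simp
      · convert hm using 1
        ext z; simp

lemma hW_image (β : ℝ) (hβ : 1 < β) (w : List Bool) (A : Set ℝ) (hA : A ⊆ Ico (0:ℝ) 1) :
    hW β w '' A = {z | z ∈ Ico (0:ℝ) 1 ∧ (MannevillePomeau β)^[w.length] z ∈ A ∧ code β w.length z = w} := by
  ext z; constructor
  · rintro ⟨x, hx, rfl⟩
    obtain ⟨h1, h2⟩ := hW_spec β hβ w x (hA hx)
    exact ⟨h1, by rw [h2]; exact hx, code_hW β hβ w x (hA hx)⟩
  · rintro ⟨h1, h2, h3⟩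
    refine ⟨_, h2, ?_⟩
    have := hW_code β hβ w.length z h1
    rwa [h3] at this

lemma hW_image_meas (β : ℝ) (hβ : 1 < β) (w : List Bool) (A : Set ℝ) (hA : A ⊆ Ico (0:ℝ) 1) (hm : MeasurableSet A) :
    MeasurableSet (hW β w '' A) := by
  rw [hW_image β hβ w A hA]
  exact measurableSet_Ico.inter ((T_iter_meas β _ hm).inter (code_meas β _ w))

lemma vol_decomp (β : ℝ) (k : ℕ) (S : Set ℝ) (hS : MeasurableSet S) :
    volume S = ∑' w : List Bool, volume (S ∩ {z | code β k z = w}) := by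
  rw [← measure_iUnion]
  · congr 1; ext z; simp
  · intro w w' hww
    apply Disjoint.mono inter_subset_right inter_subset_right
    rw [Set.disjoint_left]
    intro z h1 h2
    exact hww (h1.symm.trans h2)
  · intro w; exact hS.inter (code_meas β k w)

/-- preimage of A decomposed in branch images -/
lemma vol_decomp' (β : ℝ) (hβ : 1 < β) (k : ℕ) (A : Set ℝ) (hA : A ⊆ Ico (0:ℝ) 1) (hm : MeasurableSet A) :
    volume (Ico (0:ℝ) 1 ∩ (MannevillePomeau β)^[k] ⁻¹' A)
      = ∑' w : List Bool, if w.length = k then volume (hW β w '' A) else 0 := by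
  rw [vol_decomp β k _ (measurableSet_Ico.inter (T_iter_meas β k hm))]
  congr 1; ext w
  split_ifs with h
  · subst h
    rw [hW_image β hβ w A hA]
    congr 1; ext z; simp [and_assoc]
  · convert measure_empty (μ := (volume : Measure ℝ))
    ext z; simp
    intro _ _ _ h2
    exact h (by rw [← h2, code_length])


lemma vol_lip (f : ℝ → ℝ) (A : Set ℝ) (K : ℝ) (hK : 0 ≤ K)
    (h : ∀ u ∈ A, ∀ v ∈ A, |f u - f v| ≤ K * |u - v|) : volume (f '' A) ≤ ENNReal.ofReal K * volume A := by
  have hl : LipschitzOnWith K.toNNReal f A := by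
    apply LipschitzOnWith.of_dist_le_mul
    intro u hu v hv
    rw [Real.dist_eq, Real.dist_eq, Real.coe_toNNReal _ hK]
    exact h u hu v hv
  have := hl.hausdorffMeasure_image_le (d := 1) zero_le_one
  rw [hausdorffMeasure_real, ENNReal.rpow_one] at this
  exact this

lemma abs_mono_aux (a b K p q : ℝ) (hpq : p ≤ q → a ≤ b ∧ b - a ≤ K * (q - p))
   (hqp : q ≤ p → b ≤ a ∧ a - b ≤ K * (p - q)) : |a - b| ≤ K * |p - q| := by
  rcases le_total p q with h | h
  · obtain ⟨h1, h2⟩ := hpq h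
    rw [abs_of_nonpos (by linarith), abs_of_nonpos (by linarith)]; linarith
  · obtain ⟨h1, h2⟩ := hqp h
    rw [abs_of_nonneg (by linarith), abs_of_nonneg (by linarith)]; linarith

lemma hW_vol_le (β : ℝ) (hβ : 1 < β) (w : List Bool) (a : ℝ) (ha : a ∈ Icc (0:ℝ) 1) (A : Set ℝ) (hA : A ⊆ Icc a 1) :
    volume (hW β w '' A) ≤ ENNReal.ofReal (dW β w a) * volume A := by
  apply vol_lip _ _ _ (dW_pos β hβ w a ha).le
  have key : ∀ u ∈ A, ∀ v ∈ A, u ≤ v → hW β w u ≤ hW β w v ∧ hW β w v - hW β w u ≤ dW β w a * (v - u) := by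
    intro u hu v hv huv
    have hu' : u ∈ Icc (0:ℝ) 1 := ⟨ha.1.trans (hA hu).1, (hA hu).2⟩
    have hv' : v ∈ Icc (0:ℝ) 1 := ⟨ha.1.trans (hA hv).1, (hA hv).2⟩
    have h1 := hW_hi β hβ w u v hu' hv'
    have h2 := dW_anti β hβ w a u ha hu' (hA hu).1
    refine ⟨hW_mono β hβ w u v hu' hv' huv, ?_⟩
    nlinarith
  intro u hu v hv
  exact abs_mono_aux _ _ _ _ _ (key u hu v hv) (key v hv u hu)

lemma hW_vol_ge (β : ℝ) (hβ : 1 < β) (w : List Bool) (c : ℝ) (hc : c ∈ Icc (0:ℝ) 1) (A : Set ℝ) (hA : A ⊆ Ico 0 1)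
    (hAc : A ⊆ Icc 0 c) :
    ENNReal.ofReal (dW β w c) * volume A ≤ volume (hW β w '' A) := by
  have hd := dW_pos β hβ w c hc
  have e : (MannevillePomeau β)^[w.length] '' (hW β w '' A) = A := by
    rw [image_image]
    calc _ = (fun x => x) '' A := image_congr (fun x hx => (hW_spec β hβ w x (hA hx)).2)
      _ = A := by simp
  have key : ∀ u ∈ A, ∀ v ∈ A, dW β w c * |u - v| ≤ |hW β w u - hW β w v| := by
    have k0 : ∀ u ∈ A, ∀ v ∈ A, u ≤ v → dW β w c * |u - v| ≤ |hW β w u - hW β w v| := by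
      intro u hu v hv huv
      have hu' : u ∈ Icc (0:ℝ) 1 := ⟨(hA hu).1, (hA hu).2.le⟩
      have hv' : v ∈ Icc (0:ℝ) 1 := ⟨(hA hv).1, (hA hv).2.le⟩
      have h1 := hW_lo β hβ w u v hu' hv'
      have h2 := dW_anti β hβ w v c hv' hc (hAc hv).2
      have h3 := hW_mono β hβ w u v hu' hv' huv
      rw [abs_of_nonpos (by linarith), abs_of_nonpos (by linarith)]
      nlinarith
    intro u hu v hv
    rcases le_total u v with h | h
    · exact k0 u hu v hv h
    · rw [abs_sub_comm u, abs_sub_comm (hW β w u)]; exact k0 v hv u hu h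
  have h := vol_lip ((MannevillePomeau β)^[w.length]) (hW β w '' A) (dW β w c)⁻¹ (by positivity) (by
    rintro _ ⟨u, hu, rfl⟩ _ ⟨v, hv, rfl⟩
    rw [(hW_spec β hβ w u (hA hu)).2, (hW_spec β hβ w v (hA hv)).2]
    rw [← div_eq_inv_mul, le_div_iff₀ hd, mul_comm]
    exact key u hu v hv)
  rw [e, ENNReal.ofReal_inv_of_pos hd] at h
  calc _ ≤ ENNReal.ofReal (dW β w c) * ((ENNReal.ofReal (dW β w c))⁻¹ * volume (hW β w '' A)) := by gcongr
    _ = _ := by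
      rw [← mul_assoc, ENNReal.mul_inv_cancel (by simpa using hd) (by simp), one_mul]

lemma J_sub : Ico (1/2:ℝ) 1 ⊆ Ico (0:ℝ) 1 := Ico_subset_Ico_left (by norm_num)

lemma hW_J_cyl (β : ℝ) (hβ : 1 < β) (w : List Bool) (A : Set ℝ) (hA : A ⊆ Ico (1/2) 1) :
    volume (hW β w '' A) ≤ 2 * volume (hW β w '' (Ico 0 1)) * volume A := by
  have h1 := hW_vol_le β hβ w (1/2) ⟨by norm_num, by norm_num⟩ A (hA.trans Ico_subset_Icc_self)
  have h2 := hW_vol_ge β hβ w (1/2) ⟨by norm_num, by norm_num⟩ (Ico 0 (1/2)) (Ico_subset_Ico_right (by norm_num))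
    Ico_subset_Icc_self
  have h3 : volume (hW β w '' (Ico 0 (1/2))) ≤ volume (hW β w '' (Ico 0 1)) := 
    measure_mono (image_mono (Ico_subset_Ico_right (by norm_num)))
  refine h1.trans ?_
  gcongr
  calc ENNReal.ofReal (dW β w (1/2)) = 2 * (ENNReal.ofReal (dW β w (1/2)) * volume (Ico (0:ℝ) (1/2))) := by
        rw [Real.volume_Ico, mul_left_comm]
        have : (2:ENNReal) * ENNReal.ofReal (1/2 - 0) = 1 := by
          rw [← ENNReal.ofReal_ofNat, ← ENNReal.ofReal_mul (by norm_num)]; norm_num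
        rw [this, mul_one]
    _ ≤ _ := by gcongr; exact h2.trans h3

lemma hW_J_J (β : ℝ) (hβ : 1 < β) (hβ2 : β < 2) (w : List Bool) (A : Set ℝ) (hA : A ⊆ Ico (1/2) 1) :
    volume (hW β w '' A) ≤ 8 * volume (hW β w '' (Ico (1/2) 1)) * volume A := by
  have h1 := hW_vol_le β hβ w (1/2) ⟨by norm_num, by norm_num⟩ A (hA.trans Ico_subset_Icc_self)
  have h2 := hW_vol_ge β hβ w 1 ⟨by norm_num, by norm_num⟩ (Ico (1/2) 1) J_sub
    (J_sub.trans Ico_subset_Icc_self)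
  refine h1.trans ?_
  gcongr
  have h3 := dW_dist β hβ hβ2 w
  calc ENNReal.ofReal (dW β w (1/2)) ≤ ENNReal.ofReal (4 * dW β w 1) := ENNReal.ofReal_le_ofReal h3
    _ = 8 * (ENNReal.ofReal (dW β w 1) * volume (Ico (1/2:ℝ) 1)) := by
        rw [Real.volume_Ico, mul_left_comm, mul_comm 4, ENNReal.ofReal_mul (dW_pos β hβ w 1 ⟨by norm_num, by norm_num⟩).le]
        have : (8:ENNReal) * ENNReal.ofReal (1 - 1/2) = ENNReal.ofReal 4 := by
          rw [← ENNReal.ofReal_ofNat, ← ENNReal.ofReal_mul (by norm_num)]; norm_num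
        rw [this]
    _ ≤ _ := by gcongr

/-- preimage set -/
def pre (β : ℝ) (k : ℕ) (A : Set ℝ) : Set ℝ := Ico (0:ℝ) 1 ∩ (MannevillePomeau β)^[k] ⁻¹' A

lemma pre_meas (β : ℝ) (k : ℕ) (A : Set ℝ) (hm : MeasurableSet A) : MeasurableSet (pre β k A) :=
  measurableSet_Ico.inter (T_iter_meas β k hm)

lemma pre_univ (β : ℝ) (hβ : 1 < β) (k : ℕ) : pre β k (Ico 0 1) = Ico (0:ℝ) 1 := by
  ext z; simp only [pre, mem_inter_iff, mem_preimage]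
  exact ⟨fun h => h.1, fun h => ⟨h, T_iter_mem β hβ k z h⟩⟩

lemma pre_le (β : ℝ) (hβ : 1 < β) (k : ℕ) (A : Set ℝ) (hA : A ⊆ Ico (1/2) 1) (hm : MeasurableSet A) :
    volume (pre β k A) ≤ 2 * volume A := by
  have h1 := vol_decomp' β hβ k (Ico 0 1) subset_rfl measurableSet_Ico
  have h2 := vol_decomp' β hβ k A (hA.trans J_sub) hm
  have h3 := pre_univ β hβ k
  unfold pre at *
  rw [h3, Real.volume_Ico] at h1
  rw [h2]
  calc _ ≤ ∑' w : List Bool, 2 * volume A * (if w.length = k then volume (hW β w '' (Ico 0 1)) else 0) := by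
        apply ENNReal.tsum_le_tsum
        intro w
        split_ifs with h
        · refine (hW_J_cyl β hβ w A hA).trans (le_of_eq (by ring))
        · simp
    _ = _ := by rw [ENNReal.tsum_mul_left, ← h1]; simp

lemma pre_le' (β : ℝ) (hβ : 1 < β) (hβ2 : β < 2) (k : ℕ) (A : Set ℝ) (hA : A ⊆ Ico (1/2) 1) (hm : MeasurableSet A) :
    volume (pre β k A) ≤ 8 * volume (pre β k (Ico (1/2) 1)) * volume A := by
  have h1 := vol_decomp' β hβ k (Ico (1/2) 1) J_sub measurableSet_Ico
  have h2 := vol_decomp' β hβ k A (hA.trans J_sub) hm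
  unfold pre at *
  rw [h2, h1]
  calc _ ≤ ∑' w : List Bool, 8 * volume A * (if w.length = k then volume (hW β w '' (Ico (1/2) 1)) else 0) := by
        apply ENNReal.tsum_le_tsum
        intro w
        split_ifs with h
        · refine (hW_J_J β hβ hβ2 w A hA).trans (le_of_eq (by ring))
        · simp
    _ = _ := by rw [ENNReal.tsum_mul_left]; ring


lemma code_true (β : ℝ) (z : ℝ) (hz : 1/2 ≤ z) : ∀ k, 0 < k → true ∈ code β k z := by
  intro k
  induction k with
  | zero => intro h; omega
  | succ k ih =>
    intro _
    rcases Nat.eq_zero_or_pos k with rfl | h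
    · simp only [code, Function.iterate_zero, id]; simp; linarith
    · exact List.mem_cons_of_mem _ (ih h)

/-- close return set -/
def closeRet (β : ℝ) (k : ℕ) (ρ : ℝ) : Set ℝ :=
  {z | z ∈ Ico (1/2:ℝ) 1 ∧ (MannevillePomeau β)^[k] z ∈ Ico (1/2:ℝ) 1 ∧ |z - (MannevillePomeau β)^[k] z| < ρ}

lemma closeRet_meas (β : ℝ) (k : ℕ) (ρ : ℝ) : MeasurableSet (closeRet β k ρ) := by
  refine measurableSet_Ico.inter (((T_iter_meas β k) measurableSet_Ico).inter ?_)
  exact measurableSet_lt ((measurable_id.sub (T_iter_meas β k)).abs) measurable_const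

lemma closeRet_le (β : ℝ) (hβ : 1 < β) (k : ℕ) (hk : 0 < k) (ρ : ℝ) (hρ : 0 < ρ) :
    volume (closeRet β k ρ) ≤ 8 * ENNReal.ofReal ρ := by
  rw [vol_decomp β k _ (closeRet_meas β k ρ)]
  have h1 := vol_decomp' β hβ k (Ico 0 1) subset_rfl measurableSet_Ico
  have h3 := pre_univ β hβ k
  unfold pre at h3
  rw [h3, Real.volume_Ico] at h1
  calc _ ≤ ∑' w : List Bool, 8 * ENNReal.ofReal ρ * (if w.length = k then volume (hW β w '' (Ico 0 1)) else 0) := by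
        apply ENNReal.tsum_le_tsum
        intro w
        by_cases hne : (closeRet β k ρ ∩ {z | code β k z = w}).Nonempty
        swap
        · rw [not_nonempty_iff_eq_empty.1 hne]; simp
        obtain ⟨z0, hz0, hcz⟩ := hne
        have hcz : code β k z0 = w := hcz
        have hlen : w.length = k := by rw [← hcz, code_length]
        rw [if_pos hlen]
        have htrue : true ∈ w := by rw [← hcz]; exact code_true β z0 hz0.1.1 k hk
        have hd : ∀ x ∈ Icc (0:ℝ) 1, dW β w x ≤ 1/2 := by
          intro x hx
          refine (dW_le β hβ w x hx).trans ?_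
          have : 1 ≤ w.count true := List.one_le_count_iff.2 htrue
          calc (1/2:ℝ)^(w.count true) ≤ (1/2:ℝ)^1 := pow_le_pow_of_le_one (by norm_num) (by norm_num) this
            _ = _ := by norm_num
        set Y : Set ℝ := {y | y ∈ Ico (1/2:ℝ) 1 ∧ |hW β w y - y| < ρ} with hY
        have hsub : closeRet β k ρ ∩ {z | code β k z = w} ⊆ hW β w '' Y := by
          rintro z ⟨hz, hzc⟩
          have hzc : code β k z = w := hzc
          have hh := hW_code β hβ k z (J_sub hz.1)
          rw [hzc] at hh
          refine ⟨_, ⟨hz.2.1, ?_⟩, hh⟩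
          rw [hh]; exact hz.2.2
        have hYJ : Y ⊆ Ico (1/2) 1 := fun y hy => hy.1
        have hkey : ∀ u ∈ Y, ∀ v ∈ Y, u ≤ v → v - u ≤ 4 * ρ := by
          intro u hu v hv huv
          have hu' : u ∈ Icc (0:ℝ) 1 := Ico_subset_Icc_self (J_sub hu.1)
          have hv' : v ∈ Icc (0:ℝ) 1 := Ico_subset_Icc_self (J_sub hv.1)
          have t1 := hW_hi β hβ w u v hu' hv'
          have t2 := hd u hu'
          have t3 := abs_lt.1 hu.2
          have t4 := abs_lt.1 hv.2
          nlinarith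
        have hvol : volume Y ≤ ENNReal.ofReal (4 * ρ) := by
          refine (Real.volume_le_diam Y).trans ?_
          apply Metric.ediam_le
          intro u hu v hv
          rw [edist_dist]
          apply ENNReal.ofReal_le_ofReal
          rw [Real.dist_eq]
          rcases le_total u v with h | h
          · rw [abs_sub_comm, abs_of_nonneg (by linarith)]; exact hkey u hu v hv h
          · rw [abs_of_nonneg (by linarith)]; exact hkey v hv u hu h
        refine (measure_mono hsub).trans ((hW_J_cyl β hβ w Y hYJ).trans ?_)
        calc _ ≤ 2 * volume (hW β w '' Ico 0 1) * ENNReal.ofReal (4 * ρ) := by gcongr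
          _ = _ := by
            rw [ENNReal.ofReal_mul (by norm_num), ENNReal.ofReal_ofNat]; ring
    _ = _ := by rw [ENNReal.tsum_mul_left, ← h1]; simp

/-- two visits which are close -/
def pairClose (β : ℝ) (n m : ℕ) (ρ : ℝ) : Set ℝ :=
  {x | x ∈ Ico (0:ℝ) 1 ∧ (MannevillePomeau β)^[n] x ∈ Ico (1/2:ℝ) 1 ∧ (MannevillePomeau β)^[m] x ∈ Ico (1/2:ℝ) 1 ∧
    |(MannevillePomeau β)^[n] x - (MannevillePomeau β)^[m] x| < ρ}

lemma pairClose_le (β : ℝ) (hβ : 1 < β) (n m : ℕ) (hnm : n ≠ m) (ρ : ℝ) (hρ : 0 < ρ) :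
    volume (pairClose β n m ρ) ≤ 16 * ENNReal.ofReal ρ := by
  wlog h : n < m generalizing n m
  · have := this m n hnm.symm (by omega)
    refine le_trans (measure_mono ?_) this
    rintro x ⟨h1, h2, h3, h4⟩
    exact ⟨h1, h3, h2, by rw [abs_sub_comm]; exact h4⟩
  have e : pairClose β n m ρ ⊆ pre β n (closeRet β (m - n) ρ) := by
    rintro x ⟨h1, h2, h3, h4⟩
    have : (MannevillePomeau β)^[m - n] ((MannevillePomeau β)^[n] x) = (MannevillePomeau β)^[m] x := by
      rw [← Function.iterate_add_apply]; congr 2; omega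
    refine ⟨h1, h2, ?_, ?_⟩
    · rw [this]; exact h3
    · rw [this]; exact h4
  calc _ ≤ volume (pre β n (closeRet β (m - n) ρ)) := measure_mono e
    _ ≤ 2 * volume (closeRet β (m - n) ρ) := pre_le β hβ n _ (fun z hz => hz.1) (closeRet_meas β _ ρ)
    _ ≤ 2 * (8 * ENNReal.ofReal ρ) := by gcongr; exact closeRet_le β hβ _ (by omega) ρ hρ
    _ = _ := by ring


lemma lyap_real (β : ℝ) (hβ : 1 < β) (hβ2 : β < 2) (x : ℝ) (hx : 0 < x) (hx2 : x < 1/2) :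
    0 < MannevillePomeau β x ∧ (MannevillePomeau β x) ^ (-(β - 1)) + (β - 1) / 2 ≤ x ^ (-(β - 1)) := by
  set b := β - 1 with hb
  have hb0 : 0 < b := by linarith
  have hb1 : b < 1 := by linarith
  set w : ℝ := 2 ^ b * x ^ b with hw
  have hw0 : 0 < w := by positivity
  have hw1 : w ≤ 1 := by
    rw [hw, ← Real.mul_rpow (by norm_num) hx.le]
    exact Real.rpow_le_one (by linarith) (by linarith) hb0.le
  have e : MannevillePomeau β x = x * (1 + w) := by
    simp only [MannevillePomeau, if_pos hx2, hw]
    have : x ^ β = x ^ b * x := by rw [hb, Real.rpow_sub_one hx.ne']; field_simp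
    rw [this]; ring
  rw [e]
  refine ⟨by positivity, ?_⟩
  rw [Real.mul_rpow hx.le (by linarith)]
  have h1 : (1 + w) ^ (-b) ≤ 1 - b * (w / 2) := by
    have t := rpow_one_add_le_one_add_mul_self (s := - (w / (1 + w))) (p := b)
      (by rw [neg_le_neg_iff, div_le_one (by linarith)]; linarith) hb0.le hb1.le
    have e2 : 1 + -(w / (1 + w)) = (1 + w)⁻¹ := by field_simp; ring
    rw [e2, Real.inv_rpow (by linarith), ← Real.rpow_neg (by linarith)] at t
    have : w / 2 ≤ w / (1 + w) := by gcongr; linarith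
    nlinarith
  have hp : 0 < x ^ (-b) := by positivity
  have h2 : x ^ (-b) * w = 2 ^ b := by
    rw [hw, Real.rpow_neg hx.le]; field_simp
  have h3 : (1:ℝ) ≤ 2 ^ b := Real.one_le_rpow (by norm_num) hb0.le
  have h4 : x ^ (-b) * (1 + w) ^ (-b) ≤ x ^ (-b) * (1 - b * (w / 2)) := by gcongr
  have h5 : x ^ (-b) * (1 - b * (w / 2)) = x ^ (-b) - b / 2 * (x ^ (-b) * w) := by ring
  rw [h5, h2] at h4
  nlinarith

/-- Lyapunov function -/
noncomputable def WW (β x : ℝ) : ENNReal := (ENNReal.ofReal x) ^ (-(β - 1))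

lemma WW_meas (β : ℝ) : Measurable (WW β) := by unfold WW; fun_prop

lemma WW_pos (β x : ℝ) (hx : 0 < x) : WW β x = ENNReal.ofReal (x ^ (-(β - 1))) := by
  unfold WW; rw [ENNReal.ofReal_rpow_of_pos hx]

lemma lyap (β : ℝ) (hβ : 1 < β) (hβ2 : β < 2) (x : ℝ) (hx : 0 ≤ x) (hx2 : x < 1/2) :
    WW β (MannevillePomeau β x) + ENNReal.ofReal ((β - 1) / 2) ≤ WW β x := by
  rcases hx.eq_or_lt with rfl | hx
  · have : WW β 0 = ⊤ := by
      unfold WW; rw [ENNReal.ofReal_zero, ENNReal.zero_rpow_of_neg (by linarith)]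
    rw [this]; exact le_top
  · obtain ⟨h1, h2⟩ := lyap_real β hβ hβ2 x hx hx2
    rw [WW_pos β _ h1, WW_pos β _ hx, ← ENNReal.ofReal_add (by positivity) (by linarith)]
    exact ENNReal.ofReal_le_ofReal h2

lemma WW_int (β : ℝ) (hβ2 : β < 2) : ∫⁻ x in Ico (0:ℝ) 1, WW β x < ⊤ := by
  have h := intervalIntegral.intervalIntegrable_rpow' (a := 0) (b := 1) (r := -(β - 1)) (by linarith)
  rw [intervalIntegrable_iff_integrableOn_Ioo_of_le zero_le_one] at h
  rw [setLIntegral_congr (Ioo_ae_eq_Ico (a := (0:ℝ)) (b := 1)).symm]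
  have h2 := h.lintegral_lt_top
  refine lt_of_le_of_lt (le_of_eq ?_) h2
  apply setLIntegral_congr_fun measurableSet_Ioo
  intro x hx
  exact WW_pos β x hx.1

lemma WW_int2 (β : ℝ) (hβ2 : β < 2) : ∫⁻ x in Ico (1/2:ℝ) 1, WW β (MannevillePomeau β x) < ⊤ := by
  have h := intervalIntegral.intervalIntegrable_rpow' (a := 0) (b := 1) (r := -(β - 1)) (by linarith)
  have h := (h.comp_sub_right 1).comp_mul_left (c := 2)
  norm_num at h
  rw [intervalIntegrable_iff_integrableOn_Ioo_of_le (by norm_num)] at h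
  rw [setLIntegral_congr (Ioo_ae_eq_Ico (a := (1/2:ℝ)) (b := 1)).symm]
  have h2 := h.lintegral_lt_top
  refine lt_of_le_of_lt (le_of_eq ?_) h2
  apply setLIntegral_congr_fun measurableSet_Ioo
  intro x hx
  have hx1 := hx.1
  have e : MannevillePomeau β x = 2 * x - 1 := by
    simp only [MannevillePomeau, if_neg (not_lt.2 hx1.le)]
  simp only
  rw [e, WW_pos β _ (by linarith)]
  congr 2; ring

lemma push_le (β : ℝ) (hβ : 1 < β) (hβ2 : β < 2) (k : ℕ) (φ : ℝ → ENNReal) (hφ : Measurable φ) :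
    ∫⁻ x in pre β k (Ico (1/2) 1), φ ((MannevillePomeau β)^[k] x) ≤
      8 * volume (pre β k (Ico (1/2) 1)) * ∫⁻ y in Ico (1/2:ℝ) 1, φ y := by
  have hle : Measure.map ((MannevillePomeau β)^[k]) (volume.restrict (pre β k (Ico (1/2) 1))) ≤
      (8 * volume (pre β k (Ico (1/2) 1))) • volume.restrict (Ico (1/2:ℝ) 1) := by
    rw [Measure.le_iff]
    intro A hA
    rw [Measure.map_apply (T_iter_meas β k) hA, Measure.restrict_apply (T_iter_meas β k hA),
      Measure.smul_apply, Measure.restrict_apply hA, smul_eq_mul]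
    refine le_trans (measure_mono ?_) (pre_le' β hβ hβ2 k (A ∩ Ico (1/2) 1) inter_subset_right (hA.inter measurableSet_Ico))
    rintro x ⟨h1, h2, h3⟩
    exact ⟨h2, h1, h3⟩
  rw [← lintegral_map hφ (T_iter_meas β k)]
  refine (lintegral_mono' hle le_rfl).trans ?_
  rw [lintegral_smul_measure, smul_eq_mul]

lemma visits_step (β : ℝ) (hβ : 1 < β) (hβ2 : β < 2) (n : ℕ) :
    (∫⁻ x in Ico (0:ℝ) 1, WW β ((MannevillePomeau β)^[n+1] x)) + ENNReal.ofReal ((β - 1) / 2) * volume (Ico (0:ℝ) 1 \ pre β n (Ico (1/2) 1))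
    ≤ (∫⁻ x in Ico (0:ℝ) 1, WW β ((MannevillePomeau β)^[n] x)) +
      8 * volume (pre β n (Ico (1/2) 1)) * ∫⁻ y in Ico (1/2:ℝ) 1, WW β (MannevillePomeau β y) := by
  have hm := pre_meas β n _ (measurableSet_Ico (a := (1/2:ℝ)) (b := 1))
  have hsub : pre β n (Ico (1/2) 1) ⊆ Ico (0:ℝ) 1 := inter_subset_left
  have hsplit : ∀ φ : ℝ → ENNReal, ∫⁻ x in Ico (0:ℝ) 1, φ x = (∫⁻ x in pre β n (Ico (1/2) 1), φ x) + ∫⁻ x in Ico (0:ℝ) 1 \ pre β n (Ico (1/2) 1), φ x := by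
    intro φ
    have := lintegral_inter_add_sdiff (μ := volume) φ (Ico (0:ℝ) 1) hm
    rw [inter_eq_self_of_subset_right hsub] at this
    exact this.symm
  rw [hsplit (fun x => WW β ((MannevillePomeau β)^[n+1] x))]
  have h1 := push_le β hβ hβ2 n (fun y => WW β (MannevillePomeau β y)) ((WW_meas β).comp (T_meas β))
  have h2 : (∫⁻ x in Ico (0:ℝ) 1 \ pre β n (Ico (1/2) 1), WW β ((MannevillePomeau β)^[n+1] x)) + ENNReal.ofReal ((β - 1) / 2) * volume (Ico (0:ℝ) 1 \ pre β n (Ico (1/2) 1)) ≤ ∫⁻ x in Ico (0:ℝ) 1, WW β ((MannevillePomeau β)^[n] x) := by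
    rw [← setLIntegral_const, ← lintegral_add_right _ measurable_const]
    refine le_trans ?_ (lintegral_mono_set (s := Ico (0:ℝ) 1 \ pre β n (Ico (1/2) 1)) sdiff_subset)
    apply setLIntegral_mono' (measurableSet_Ico.diff hm)
    rintro x ⟨hx, hx2⟩
    rw [Function.iterate_succ_apply']
    have hmem := T_iter_mem β hβ n x hx
    apply lyap β hβ hβ2 _ hmem.1
    by_contra hc
    exact hx2 ⟨hx, not_lt.1 hc, hmem.2⟩
  simp only [← Function.iterate_succ_apply' (MannevillePomeau β)] at h1
  calc _ = _ + ((∫⁻ x in Ico (0:ℝ) 1 \ pre β n (Ico (1/2) 1), WW β ((MannevillePomeau β)^[n+1] x)) + ENNReal.ofReal ((β - 1) / 2) * volume (Ico (0:ℝ) 1 \ pre β n (Ico (1/2) 1))) := by rw [add_assoc]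
    _ ≤ _ := add_le_add h1 h2
    _ = _ := by rw [add_comm]

lemma visits (β : ℝ) (hβ : 1 < β) (hβ2 : β < 2) : ∃ δ A : ℝ, 0 < δ ∧ 0 ≤ A ∧ ∀ N : ℕ,
    δ * N - A ≤ ∑ n ∈ Finset.range N, (volume (pre β n (Ico (1/2) 1))).toReal := by
  set a0 := ∫⁻ x in Ico (0:ℝ) 1, WW β x with ha0
  set C := ∫⁻ y in Ico (1/2:ℝ) 1, WW β (MannevillePomeau β y) with hC
  set p : ℕ → ENNReal := fun n => volume (pre β n (Ico (1/2) 1)) with hp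
  set q : ℕ → ENNReal := fun n => volume (Ico (0:ℝ) 1 \ pre β n (Ico (1/2) 1)) with hq
  have ha0f : a0 ≠ ⊤ := (WW_int β hβ2).ne
  have hCf : C ≠ ⊤ := (WW_int2 β hβ2).ne
  have hind : ∀ N : ℕ, (∫⁻ x in Ico (0:ℝ) 1, WW β ((MannevillePomeau β)^[N] x)) + ENNReal.ofReal ((β - 1) / 2) * ∑ n ∈ Finset.range N, q n
     ≤ a0 + 8 * (∑ n ∈ Finset.range N, p n) * C := by
    intro N
    induction N with
    | zero => simp [ha0]
    | succ N ih =>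
      rw [Finset.sum_range_succ, Finset.sum_range_succ]
      calc _ = ((∫⁻ x in Ico (0:ℝ) 1, WW β ((MannevillePomeau β)^[N+1] x)) + ENNReal.ofReal ((β - 1) / 2) * q N) + ENNReal.ofReal ((β - 1) / 2) * ∑ n ∈ Finset.range N, q n := by ring
        _ ≤ ((∫⁻ x in Ico (0:ℝ) 1, WW β ((MannevillePomeau β)^[N] x)) + 8 * p N * C) + ENNReal.ofReal ((β - 1) / 2) * ∑ n ∈ Finset.range N, q n := by
            gcongr ?_ + _; exact visits_step β hβ hβ2 N
        _ = ((∫⁻ x in Ico (0:ℝ) 1, WW β ((MannevillePomeau β)^[N] x)) + ENNReal.ofReal ((β - 1) / 2) * ∑ n ∈ Finset.range N, q n) + 8 * p N * C := by ring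
        _ ≤ (a0 + 8 * (∑ n ∈ Finset.range N, p n) * C) + 8 * p N * C := by gcongr
        _ = _ := by ring
  have hpq : ∀ n, p n + q n = 1 := by
    intro n
    have hm := pre_meas β n _ (measurableSet_Ico (a := (1/2:ℝ)) (b := 1))
    have hsub : pre β n (Ico (1/2) 1) ⊆ Ico (0:ℝ) 1 := inter_subset_left
    have := measure_inter_add_sdiff (μ := volume) (Ico (0:ℝ) 1) hm
    rw [inter_eq_self_of_subset_right hsub] at this
    rw [hp, hq]; simp only; rw [this]; simp
  have hpf : ∀ n, p n ≠ ⊤ := fun n => ne_top_of_le_ne_top ENNReal.one_ne_top (by rw [← hpq n]; exact le_self_add)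
  have hqf : ∀ n, q n ≠ ⊤ := fun n => ne_top_of_le_ne_top ENNReal.one_ne_top (by rw [← hpq n]; exact le_add_self)
  set c := (β - 1) / 2 with hc
  have hc0 : 0 < c := by rw [hc]; linarith
  set K := 8 * C.toReal + c with hK
  have hK0 : 0 < K := by have := C.toReal_nonneg; positivity
  refine ⟨c / K, a0.toReal / K, by positivity, by positivity, ?_⟩
  intro N
  have h1 : ENNReal.ofReal c * ∑ n ∈ Finset.range N, q n ≤ a0 + 8 * (∑ n ∈ Finset.range N, p n) * C := le_add_self.trans (hind N)
  have hsp : ∑ n ∈ Finset.range N, p n ≠ ⊤ := ENNReal.sum_ne_top.2 (fun n _ => hpf n)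
  have h2 := ENNReal.toReal_mono (by
    apply ENNReal.add_ne_top.2 ⟨ha0f, ENNReal.mul_ne_top (ENNReal.mul_ne_top (by simp) hsp) hCf⟩) h1
  rw [ENNReal.toReal_add ha0f (ENNReal.mul_ne_top (ENNReal.mul_ne_top (by simp) hsp) hCf), ENNReal.toReal_mul, ENNReal.toReal_mul, ENNReal.toReal_mul,
    ENNReal.toReal_sum (fun n _ => hpf n), ENNReal.toReal_sum (fun n _ => hqf n), ENNReal.toReal_ofReal hc0.le] at h2
  have h3 : ∑ n ∈ Finset.range N, (p n).toReal + ∑ n ∈ Finset.range N, (q n).toReal = N := by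
    rw [← Finset.sum_add_distrib]
    rw [Finset.sum_congr rfl (g := fun _ => (1:ℝ))]
    · simp
    · intro n _
      rw [← ENNReal.toReal_add (hpf n) (hqf n), hpq n]; simp
  rw [div_mul_eq_mul_div, ← sub_div, div_le_iff₀ hK0, hK]
  have h4 : (ENNReal.toReal 8) = 8 := by simp
  rw [h4] at h2
  change _ ≤ (∑ n ∈ Finset.range N, (p n).toReal) * _
  rw [← h3]
  nlinarith


lemma second_moment {Ω : Type*} [MeasurableSpace Ω] (μ : Measure Ω) (S : Finset ℕ) (E : ℕ → Set Ω) (hE : ∀ n, MeasurableSet (E n)) (K : ENNReal) :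
    K * ∑ n ∈ S, μ (E n) ≤ K * K * μ (⋃ n ∈ S, E n) + ∑ n ∈ S, ∑ m ∈ S, μ (E n ∩ E m) := by
  set Z : Ω → ENNReal := fun ω => ∑ n ∈ S, (E n).indicator 1 ω with hZ
  have hU : MeasurableSet (⋃ n ∈ S, E n) := S.measurableSet_biUnion (fun n _ => hE n)
  have hm : ∀ n, Measurable ((E n).indicator (1 : Ω → ENNReal)) := fun n => measurable_one.indicator (hE n)
  have h1 : ∫⁻ ω, K * Z ω ∂μ = K * ∑ n ∈ S, μ (E n) := by
    rw [lintegral_const_mul _ (Finset.measurable_sum _ (fun n _ => hm n)), lintegral_finsetSum _ (fun n _ => hm n)]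
    congr 1
    exact Finset.sum_congr rfl (fun n _ => by rw [lintegral_indicator_one (hE n)])
  have h2 : ∫⁻ ω, Z ω * Z ω ∂μ = ∑ n ∈ S, ∑ m ∈ S, μ (E n ∩ E m) := by
    simp only [hZ, Finset.sum_mul_sum]
    have hmm : ∀ n m, Measurable (fun ω => (E n).indicator (1 : Ω → ENNReal) ω * (E m).indicator (1 : Ω → ENNReal) ω) :=
      fun n m => (hm n).mul (hm m)
    rw [lintegral_finsetSum _ (fun n _ => Finset.measurable_sum _ (fun m _ => hmm n m))]
    refine Finset.sum_congr rfl (fun n _ => ?_)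
    rw [lintegral_finsetSum _ (fun m _ => hmm n m)]
    refine Finset.sum_congr rfl (fun m _ => ?_)
    rw [← lintegral_indicator_one ((hE n).inter (hE m))]
    congr 1; ext ω
    rw [inter_indicator_one]; rfl
  have h3 : ∫⁻ ω, K * K * (⋃ n ∈ S, E n).indicator 1 ω ∂μ = K * K * μ (⋃ n ∈ S, E n) := by
    rw [lintegral_const_mul _ (measurable_one.indicator hU), lintegral_indicator_one hU]
  rw [← h1, ← h2, ← h3, ← lintegral_add_left ((measurable_one.indicator hU).const_mul _)]
  apply lintegral_mono
  intro ω
  simp only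
  by_cases hω : ω ∈ ⋃ n ∈ S, E n
  · rw [indicator_of_mem hω]
    simp only [Pi.one_apply, mul_one]
    rcases le_total (Z ω) K with h | h
    · exact le_add_right (by gcongr)
    · exact le_add_left (by gcongr)
  · have : Z ω = 0 := by
      simp only [hZ]
      apply Finset.sum_eq_zero
      intro n hn
      apply indicator_of_notMem
      intro h; exact hω (mem_biUnion (x := n) hn h)
    rw [this]; simp

/-- near hits -/
def hitE (β ρ : ℝ) (n : ℕ) : Set (ℝ × ℝ) :=
  {q | q.1 ∈ Ico (0:ℝ) 1 ∧ q.2 ∈ Ico (1/2:ℝ) 1 ∧ (MannevillePomeau β)^[n] q.1 ∈ Ico (1/2:ℝ) 1 ∧ |(MannevillePomeau β)^[n] q.1 - q.2| < ρ}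

lemma hitE_meas (β ρ : ℝ) (n : ℕ) : MeasurableSet (hitE β ρ n) := by
  have h1 : Measurable (fun q : ℝ × ℝ => (MannevillePomeau β)^[n] q.1) := (T_iter_meas β n).comp measurable_fst
  refine (measurable_fst measurableSet_Ico).inter ((measurable_snd measurableSet_Ico).inter ((h1 measurableSet_Ico).inter ?_))
  exact measurableSet_lt ((h1.sub measurable_snd).abs) measurable_const

lemma hitE_ge (β ρ : ℝ) (n : ℕ) (h0 : 0 < ρ) (h1 : ρ ≤ 1/4) :
    ENNReal.ofReal ρ * volume (pre β n (Ico (1/2) 1)) ≤ volume (hitE β ρ n) := by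
  rw [Measure.volume_eq_prod, Measure.prod_apply (hitE_meas β ρ n)]
  rw [← lintegral_indicator_const (pre_meas β n _ measurableSet_Ico)]
  apply lintegral_mono
  intro x
  by_cases hx : x ∈ pre β n (Ico (1/2) 1)
  swap
  · simp only; rw [indicator_of_notMem hx]; exact zero_le
  simp only; rw [indicator_of_mem hx]
  obtain ⟨hx1, hx2⟩ := hx
  have hx2 : (MannevillePomeau β)^[n] x ∈ Ico (1/2:ℝ) 1 := hx2
  obtain ⟨hx3, hx4⟩ := hx2
  rcases le_total ((MannevillePomeau β)^[n] x) (3/4) with h | h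
  · calc ENNReal.ofReal ρ = volume (Ioo ((MannevillePomeau β)^[n] x) ((MannevillePomeau β)^[n] x + ρ)) := by
          rw [Real.volume_Ioo]; congr 1; ring
      _ ≤ _ := by
          apply measure_mono
          rintro y ⟨hy1, hy2⟩
          refine ⟨hx1, ⟨?_, ?_⟩, ⟨hx3, hx4⟩, ?_⟩ <;> simp only
          · linarith
          · linarith
          · rw [abs_lt]; constructor <;> linarith
  · calc ENNReal.ofReal ρ = volume (Ioo ((MannevillePomeau β)^[n] x - ρ) ((MannevillePomeau β)^[n] x)) := by
          rw [Real.volume_Ioo]; congr 1; ring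
      _ ≤ _ := by
          apply measure_mono
          rintro y ⟨hy1, hy2⟩
          refine ⟨hx1, ⟨?_, ?_⟩, ⟨hx3, hx4⟩, ?_⟩ <;> simp only
          · linarith
          · linarith
          · rw [abs_lt]; constructor <;> linarith

lemma vol_near (u ρ : ℝ) : volume {y : ℝ | |u - y| < ρ} = ENNReal.ofReal (2 * ρ) := by
  have : {y : ℝ | |u - y| < ρ} = Metric.ball u ρ := by
    ext y; rw [Metric.mem_ball, Real.dist_eq, abs_sub_comm]; rfl
  rw [this, Real.volume_ball]

lemma hitE_le (β ρ : ℝ) (n : ℕ) : volume (hitE β ρ n) ≤ ENNReal.ofReal (2 * ρ) := by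
  rw [Measure.volume_eq_prod, Measure.prod_apply (hitE_meas β ρ n)]
  calc _ ≤ ∫⁻ x, (Ico (0:ℝ) 1).indicator (fun _ => ENNReal.ofReal (2 * ρ)) x := by
        apply lintegral_mono
        intro x
        simp only
        by_cases hx : x ∈ Ico (0:ℝ) 1
        · rw [indicator_of_mem hx, ← vol_near ((MannevillePomeau β)^[n] x)]
          apply measure_mono
          intro y hy
          exact hy.2.2.2
        · have : Prod.mk x ⁻¹' hitE β ρ n = ∅ := by
            ext y; simp only [mem_preimage, mem_empty_iff_false, iff_false]
            intro h; exact hx h.1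
          rw [this]; simp
    _ = _ := by rw [lintegral_indicator_const measurableSet_Ico]; simp

lemma hitE_pair_le (β : ℝ) (hβ : 1 < β) (ρ : ℝ) (hρ : 0 < ρ) (n m : ℕ) (hnm : n ≠ m) :
    volume (hitE β ρ n ∩ hitE β ρ m) ≤ ENNReal.ofReal (64 * ρ * ρ) := by
  rw [Measure.volume_eq_prod, Measure.prod_apply ((hitE_meas β ρ n).inter (hitE_meas β ρ m))]
  have hpm : MeasurableSet (pairClose β n m (2 * ρ)) := by
    refine measurableSet_Ico.inter ((T_iter_meas β n measurableSet_Ico).inter ((T_iter_meas β m measurableSet_Ico).inter ?_))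
    exact measurableSet_lt (((T_iter_meas β n).sub (T_iter_meas β m)).abs) measurable_const
  calc _ ≤ ∫⁻ x, (pairClose β n m (2 * ρ)).indicator (fun _ => ENNReal.ofReal (2 * ρ)) x := by
        apply lintegral_mono
        intro x
        simp only
        by_cases hx : x ∈ pairClose β n m (2 * ρ)
        · rw [indicator_of_mem hx, ← vol_near ((MannevillePomeau β)^[n] x)]
          apply measure_mono
          intro y hy
          exact hy.1.2.2.2
        · have : Prod.mk x ⁻¹' (hitE β ρ n ∩ hitE β ρ m) = ∅ := by
            ext y; simp only [mem_preimage, mem_empty_iff_false, iff_false]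
            rintro ⟨⟨h1, h2, h3, h4⟩, h5, h6, h7, h8⟩
            simp only at h4 h8
            refine hx ⟨h1, h3, h7, ?_⟩
            rw [abs_lt] at *
            constructor <;> linarith
          rw [this]; simp
    _ = ENNReal.ofReal (2 * ρ) * volume (pairClose β n m (2 * ρ)) := by rw [lintegral_indicator_const hpm]
    _ ≤ ENNReal.ofReal (2 * ρ) * (16 * ENNReal.ofReal (2 * ρ)) := by
        gcongr; exact pairClose_le β hβ n m hnm _ (by positivity)
    _ = _ := by
        rw [← ENNReal.ofReal_ofNat 16, ← ENNReal.ofReal_mul (by norm_num), ← ENNReal.ofReal_mul (by positivity)]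
        congr 1; ring

/-- hits after time n0 at scale 1/(n+1) -/
def hitB (β : ℝ) (n0 : ℕ) : Set (ℝ × ℝ) :=
  {q | q.1 ∈ Ico (0:ℝ) 1 ∧ q.2 ∈ Ico (1/2:ℝ) 1 ∧ ∃ n ≥ n0, |(MannevillePomeau β)^[n] q.1 - q.2| < 1 / ((n:ℝ) + 1)}

lemma hitB_meas (β : ℝ) (n0 : ℕ) : MeasurableSet (hitB β n0) := by
  refine (measurable_fst measurableSet_Ico).inter ((measurable_snd measurableSet_Ico).inter ?_)
  have : {q : ℝ × ℝ | ∃ n ≥ n0, |(MannevillePomeau β)^[n] q.1 - q.2| < 1 / ((n:ℝ) + 1)} =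
    ⋃ n ≥ n0, {q : ℝ × ℝ | |(MannevillePomeau β)^[n] q.1 - q.2| < 1 / ((n:ℝ) + 1)} := by ext q; simp
  change MeasurableSet {q : ℝ × ℝ | ∃ n ≥ n0, |(MannevillePomeau β)^[n] q.1 - q.2| < 1 / ((n:ℝ) + 1)}
  rw [this]
  refine MeasurableSet.iUnion (fun n => MeasurableSet.iUnion (fun _ => ?_))
  exact measurableSet_lt ((((T_iter_meas β n).comp measurable_fst).sub measurable_snd).abs) measurable_const

lemma hitB_ge (β : ℝ) (hβ : 1 < β) (hβ2 : β < 2) : ∃ η : ENNReal, 0 < η ∧ ∀ n0, η ≤ volume (hitB β n0) := by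
  obtain ⟨δ, A, hδ, hA, hv⟩ := visits β hβ hβ2
  set K : ℝ := 264 / δ with hK
  have hK0 : 0 < K := by positivity
  refine ⟨ENNReal.ofReal (66 / (K * K)), by simpa using (by positivity), ?_⟩
  intro n0
  obtain ⟨N, hN⟩ := exists_nat_gt (2 * (A + n0) / δ + 4 + n0)
  have hNA : 2 * (A + n0) ≤ δ * N := by
    have : 2 * (A + n0) / δ ≤ N := by
      have : (0:ℝ) ≤ n0 := by positivity
      linarith
    rw [div_le_iff₀ hδ] at this; linarith
  have hq0 : 0 ≤ 2 * (A + n0) / δ := by positivity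
  have hN4 : (4:ℝ) ≤ N := by
    have : (0:ℝ) ≤ n0 := by positivity
    linarith
  have hNn : n0 ≤ N := by
    have : (n0:ℝ) ≤ N := by linarith
    exact_mod_cast this
  have hN0 : (0:ℝ) < N := by linarith
  set ρ : ℝ := 1 / N with hρ
  have hρ0 : 0 < ρ := by positivity
  have hρ1 : ρ ≤ 1/4 := by rw [hρ]; gcongr
  set S := Finset.Ico n0 N with hS
  have hsm := second_moment (volume : Measure (ℝ × ℝ)) S (hitE β ρ) (hitE_meas β ρ) (ENNReal.ofReal K)
  have hU : volume (⋃ n ∈ S, hitE β ρ n) ≤ volume (hitB β n0) := by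
    apply measure_mono
    intro q hq
    simp only [mem_iUnion] at hq
    obtain ⟨n, hn, hq⟩ := hq
    rw [hS, Finset.mem_Ico] at hn
    refine ⟨hq.1, hq.2.1, n, hn.1, hq.2.2.2.trans_le ?_⟩
    rw [hρ]
    have : (n:ℝ) + 1 ≤ N := by exact_mod_cast hn.2
    gcongr
  have hfirst : ENNReal.ofReal (δ / 2) ≤ ∑ n ∈ S, volume (hitE β ρ n) := by
    have hpf : ∀ n, volume (pre β n (Ico (1/2) 1)) ≠ ⊤ := fun n => ne_top_of_le_ne_top (by simp) (measure_mono (inter_subset_left (s := Ico (0:ℝ) 1)))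
    have hp1 : ∀ n, (volume (pre β n (Ico (1/2) 1))).toReal ≤ 1 := by
      intro n
      have h := measure_mono (μ := volume) (inter_subset_left : pre β n (Ico (1/2) 1) ⊆ Ico (0:ℝ) 1)
      have := ENNReal.toReal_mono (by simp) h
      rw [Real.volume_Ico] at this
      refine this.trans ?_
      simp
    calc ENNReal.ofReal (δ / 2) ≤ ENNReal.ofReal (ρ * ∑ n ∈ S, (volume (pre β n (Ico (1/2) 1))).toReal) := by
          apply ENNReal.ofReal_le_ofReal
          have h1 := hv N
          rw [← Finset.sum_range_add_sum_Ico _ hNn] at h1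
          have h2 : ∑ n ∈ Finset.range n0, (volume (pre β n (Ico (1/2) 1))).toReal ≤ n0 := by
            refine (Finset.sum_le_sum (fun n _ => hp1 n)).trans ?_
            simp
          rw [hρ, one_div, ← div_eq_inv_mul, le_div_iff₀ hN0]
          linarith
      _ = ∑ n ∈ S, ENNReal.ofReal ρ * volume (pre β n (Ico (1/2) 1)) := by
          rw [ENNReal.ofReal_mul hρ0.le, ENNReal.ofReal_sum_of_nonneg (fun _ _ => ENNReal.toReal_nonneg), Finset.mul_sum]
          refine Finset.sum_congr rfl (fun n _ => ?_)
          rw [ENNReal.ofReal_toReal (hpf n)]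
      _ ≤ _ := Finset.sum_le_sum (fun n _ => hitE_ge β ρ n hρ0 hρ1)
  have hScard : (S.card : ℝ) ≤ N := by
    have : S.card ≤ N := by rw [hS, Nat.card_Ico]; omega
    exact_mod_cast this
  have hsecond : ∑ n ∈ S, ∑ m ∈ S, volume (hitE β ρ n ∩ hitE β ρ m) ≤ ENNReal.ofReal 66 := by
    have hb : ∀ n ∈ S, ∀ m ∈ S, volume (hitE β ρ n ∩ hitE β ρ m) ≤ ENNReal.ofReal ((if n = m then 2 * ρ else 0) + 64 * ρ * ρ) := by
      intro n _ m _
      split_ifs with h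
      · refine (measure_mono inter_subset_left).trans ((hitE_le β ρ n).trans ?_)
        apply ENNReal.ofReal_le_ofReal
        have : 0 ≤ 64 * ρ * ρ := by positivity
        linarith
      · rw [zero_add]; exact hitE_pair_le β hβ ρ hρ0 n m h
    have hnn : ∀ n m : ℕ, 0 ≤ ((if n = m then 2 * ρ else 0) + 64 * ρ * ρ) := by
      intro n m; split_ifs <;> positivity
    calc _ ≤ ∑ n ∈ S, ∑ m ∈ S, ENNReal.ofReal ((if n = m then 2 * ρ else 0) + 64 * ρ * ρ) :=
          Finset.sum_le_sum (fun n hn => Finset.sum_le_sum (fun m hm => hb n hn m hm))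
      _ = ENNReal.ofReal (∑ n ∈ S, ∑ m ∈ S, ((if n = m then 2 * ρ else 0) + 64 * ρ * ρ)) := by
          rw [ENNReal.ofReal_sum_of_nonneg (fun n _ => Finset.sum_nonneg (fun m _ => hnn n m))]
          refine Finset.sum_congr rfl (fun n _ => ?_)
          rw [ENNReal.ofReal_sum_of_nonneg (fun m _ => hnn n m)]
      _ ≤ _ := by
          apply ENNReal.ofReal_le_ofReal
          have : ∑ n ∈ S, ∑ m ∈ S, ((if n = m then 2 * ρ else 0) + 64 * ρ * ρ) = S.card * (2 * ρ + S.card * (64 * ρ * ρ)) := by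
            rw [Finset.sum_congr rfl (g := fun _ => 2 * ρ + S.card * (64 * ρ * ρ))]
            · rw [Finset.sum_const, nsmul_eq_mul]
            · intro n hn
              rw [Finset.sum_add_distrib, Finset.sum_ite_eq, if_pos hn, Finset.sum_const, nsmul_eq_mul]
          rw [this]
          have hNρ : (S.card:ℝ) * ρ ≤ 1 := by
            calc (S.card:ℝ) * ρ ≤ N * ρ := by gcongr
              _ = 1 := by rw [hρ]; field_simp
          have h0 : 0 ≤ (S.card:ℝ) * ρ := by positivity
          nlinarith
  have hmain : ENNReal.ofReal 132 ≤ ENNReal.ofReal (K * K) * volume (hitB β n0) + ENNReal.ofReal 66 := by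
    calc ENNReal.ofReal 132 = ENNReal.ofReal K * ENNReal.ofReal (δ / 2) := by
          rw [← ENNReal.ofReal_mul hK0.le, hK]; congr 1; field_simp; norm_num
      _ ≤ ENNReal.ofReal K * ∑ n ∈ S, volume (hitE β ρ n) := by gcongr
      _ ≤ _ := hsm
      _ ≤ ENNReal.ofReal K * ENNReal.ofReal K * volume (hitB β n0) + ENNReal.ofReal 66 := by gcongr
      _ = _ := by rw [← ENNReal.ofReal_mul hK0.le]
  have e132 : ENNReal.ofReal 132 = ENNReal.ofReal 66 + ENNReal.ofReal 66 := by
    rw [← ENNReal.ofReal_add (by norm_num) (by norm_num)]; norm_num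
  rw [e132] at hmain
  have hm2 := (ENNReal.add_le_add_iff_right ENNReal.ofReal_ne_top).1 hmain
  rw [ENNReal.ofReal_div_of_pos (by positivity)]
  exact ENNReal.div_le_of_le_mul' hm2

lemma hit_pos (β : ℝ) (hβ : 1 < β) (hβ2 : β < 2) : 0 < volume (⋂ n0, hitB β n0) := by
  obtain ⟨η, hη, h⟩ := hitB_ge β hβ hβ2
  have hfin : volume (hitB β 0) ≠ ⊤ := by
    have : hitB β 0 ⊆ Ico (0:ℝ) 1 ×ˢ Ico (1/2:ℝ) 1 := fun q hq => ⟨hq.1, hq.2.1⟩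
    refine ne_top_of_le_ne_top ?_ (measure_mono this)
    rw [Measure.volume_eq_prod, Measure.prod_prod, Real.volume_Ico, Real.volume_Ico]
    exact ENNReal.mul_ne_top ENNReal.ofReal_ne_top ENNReal.ofReal_ne_top
  have hanti : Antitone (hitB β) := by
    rintro n m hnm q ⟨h1, h2, k, hk, h3⟩
    exact ⟨h1, h2, k, hnm.trans hk, h3⟩
  have := tendsto_measure_iInter_atTop (μ := volume) (fun n => (hitB_meas β n).nullMeasurableSet) hanti ⟨0, hfin⟩
  exact hη.trans_le (ge_of_tendsto' this h)


lemma T_zero (β : ℝ) (hβ : 1 < β) (k : ℕ) : (MannevillePomeau β)^[k] 0 = 0 := by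
  apply Function.iterate_fixed
  simp only [MannevillePomeau]
  rw [if_pos (by norm_num), Real.zero_rpow (by linarith)]; simp

lemma zero_orbits (β : ℝ) (hβ : 1 < β) : ∀ᵐ z ∂(volume : Measure ℝ), z ∈ Ico (0:ℝ) 1 → ∀ n, (MannevillePomeau β)^[n] z ≠ 0 := by
  have hc : (range (fun w : List Bool => hW β w 0)).Countable := countable_range _
  have := hc.ae_notMem (volume : Measure ℝ)
  filter_upwards [this] with z hz hzI n hn
  apply hz
  refine ⟨code β n z, ?_⟩
  have := hW_code β hβ n z hzI
  rwa [hn] at this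

lemma visits_inf (β : ℝ) (hβ : 1 < β) (hβ2 : β < 2) (z : ℝ) (hz : z ∈ Ico (0:ℝ) 1)
    (h0 : ∀ n, (MannevillePomeau β)^[n] z ≠ 0) (N : ℕ) : ∃ k ≥ N, (MannevillePomeau β)^[k] z ∈ Ico (1/2:ℝ) 1 := by
  by_contra hc
  push Not at hc
  have hpos : ∀ k, 0 < (MannevillePomeau β)^[k] z := fun k => lt_of_le_of_ne (T_iter_mem β hβ k z hz).1 (h0 k).symm
  have hlt : ∀ k ≥ N, (MannevillePomeau β)^[k] z < 1/2 := by
    intro k hk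
    by_contra h
    exact hc k hk ⟨not_lt.1 h, (T_iter_mem β hβ k z hz).2⟩
  have key : ∀ j : ℕ, ((MannevillePomeau β)^[N + j] z) ^ (-(β - 1)) + j * ((β - 1) / 2) ≤ ((MannevillePomeau β)^[N] z) ^ (-(β - 1)) := by
    intro j
    induction j with
    | zero => simp
    | succ j ih =>
      have := (lyap_real β hβ hβ2 _ (hpos (N + j)) (hlt (N + j) (by omega))).2
      rw [← Function.iterate_succ_apply' (MannevillePomeau β)] at this
      rw [show N + (j + 1) = (N + j).succ by omega]
      push_cast
      linarith
  obtain ⟨j, hj⟩ := exists_nat_gt (((MannevillePomeau β)^[N] z) ^ (-(β - 1)) / ((β - 1) / 2))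
  rw [div_lt_iff₀ (by linarith)] at hj
  have h1 := key j
  have h2 : 0 < ((MannevillePomeau β)^[N + j] z) ^ (-(β - 1)) := Real.rpow_pos_of_pos (hpos _) _
  linarith

lemma count_tendsto (β : ℝ) (z : ℝ) (h : ∀ N : ℕ, ∃ k ≥ N, (MannevillePomeau β)^[k] z ∈ Ico (1/2:ℝ) 1) :
    Tendsto (fun k => (code β k z).count true) atTop atTop := by
  have hm : Monotone (fun k => (code β k z).count true) := by
    apply monotone_nat_of_le_succ
    intro n
    simp only [code]
    exact List.count_le_count_cons
  apply tendsto_atTop_atTop_of_monotone hm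
  intro b
  induction b with
  | zero => exact ⟨0, Nat.zero_le _⟩
  | succ b ih =>
    obtain ⟨a, ha⟩ := ih
    obtain ⟨k, hk, hJ⟩ := h a
    refine ⟨k + 1, ?_⟩
    have h1 := hm hk
    simp only [code] at *
    have : decide (1/2 ≤ (MannevillePomeau β)^[k] z) = true := decide_eq_true hJ.1
    rw [this, List.count_cons_self]
    omega

lemma pull_compl (β : ℝ) (hβ : 1 < β) (Y : Set ℝ)
    (hY : ∀ y ∈ Ico (0:ℝ) 1, y ∈ Y → MannevillePomeau β y ≠ 0 → MannevillePomeau β y ∈ Y) (w : List Bool) :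
    ∀ y ∈ Ico (0:ℝ) 1, y ≠ 0 → y ∉ Y → hW β w y ∉ Y := by
  induction w with
  | nil => intro y _ _ h; exact h
  | cons i w ih =>
    intro y hy hy0 hyY
    obtain ⟨h1, h2, h3⟩ := T_gB β hβ i y hy
    apply ih _ h2
    · intro h
      have := T_zero β hβ 1
      rw [Function.iterate_one] at this
      rw [h, this] at h1
      exact hy0 h1.symm
    · intro h
      have := hY _ h2 h (by rw [h1]; exact hy0)
      rw [h1] at this
      exact hyY this

lemma ergodic_aux (β : ℝ) (hβ : 1 < β) (hβ2 : β < 2) (Y : Set ℝ) (hYm : MeasurableSet Y)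
    (hpos : volume (Ico (0:ℝ) 1 ∩ Y) ≠ 0)
    (hY : ∀ y ∈ Ico (0:ℝ) 1, y ∈ Y → MannevillePomeau β y ≠ 0 → MannevillePomeau β y ∈ Y) :
    volume (Ico (1/2:ℝ) 1 \ Y) = 0 := by
  have hd := IsUnifLocDoublingMeasure.ae_tendsto_measure_inter_div (volume : Measure ℝ) Y 1
  rw [ae_restrict_iff' hYm] at hd
  have hex : ∃ z, z ∈ Ico (0:ℝ) 1 ∩ Y ∧ (∀ n, (MannevillePomeau β)^[n] z ≠ 0) ∧
      ∀ {ι : Type} {l : Filter ι} (w : ι → ℝ) (δ : ι → ℝ), Tendsto δ l (𝓝[>] 0) →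
        (∀ᶠ j in l, z ∈ Metric.closedBall (w j) (1 * δ j)) →
        Tendsto (fun j => volume (Y ∩ Metric.closedBall (w j) (δ j)) / volume (Metric.closedBall (w j) (δ j))) l (𝓝 1) := by
    by_contra hc
    push Not at hc
    apply hpos
    rw [measure_eq_zero_iff_ae_notMem]
    filter_upwards [hd, zero_orbits β hβ] with z h1 h2 hz
    obtain ⟨ι, l, w, δ, a1, a2, a3⟩ := hc z hz (h2 hz.1)
    exact a3 (h1 hz.2 w δ a1 a2)
  obtain ⟨z, ⟨hzI, hzY⟩, hz0, hden⟩ := hex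
  have hinf := visits_inf β hβ hβ2 z hzI hz0
  have hcount := count_tendsto β z hinf
  set l : Filter ℕ := atTop ⊓ 𝓟 {k | (MannevillePomeau β)^[k] z ∈ Ico (1/2:ℝ) 1} with hl
  have hlne : l.NeBot := by
    rw [hl, ← frequently_mem_iff_neBot, frequently_atTop]
    exact hinf
  have half : (1/2:ℝ) ∈ Icc (0:ℝ) 1 := by constructor <;> norm_num
  have one : (1:ℝ) ∈ Icc (0:ℝ) 1 := by constructor <;> norm_num
  set p : ℕ → ℝ := fun k => hW β (code β k z) (1/2) with hp
  set q : ℕ → ℝ := fun k => hW β (code β k z) 1 with hq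
  have hlo : ∀ k, dW β (code β k z) 1 * (1/2) ≤ q k - p k := by
    intro k
    have := hW_lo β hβ (code β k z) (1/2) 1 half one
    simp only [hp, hq]; linarith
  have hhi : ∀ k, q k - p k ≤ dW β (code β k z) (1/2) * (1/2) := by
    intro k
    have := hW_hi β hβ (code β k z) (1/2) 1 half one
    simp only [hp, hq]; linarith
  have hqp : ∀ k, 0 < q k - p k := fun k => lt_of_lt_of_le (mul_pos (dW_pos β hβ _ 1 one) (by norm_num)) (hlo k)
  have hball : ∀ k, Metric.closedBall ((p k + q k) / 2) ((q k - p k) / 2) = Icc (p k) (q k) := by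
    intro k; rw [Real.closedBall_eq_Icc]; congr 1 <;> ring
  have hδ : Tendsto (fun k => (q k - p k) / 2) l (𝓝[>] 0) := by
    rw [tendsto_nhdsWithin_iff]
    refine ⟨?_, Eventually.of_forall (fun k => by have := hqp k; simp only [mem_Ioi]; linarith)⟩
    have h1 : Tendsto (fun k => ((1/2:ℝ)) ^ ((code β k z).count true)) atTop (𝓝 0) :=
      (tendsto_pow_atTop_nhds_zero_of_lt_one (by norm_num) (by norm_num)).comp hcount
    refine squeeze_zero (fun k => by have := hqp k; linarith) (fun k => ?_) (h1.mono_left inf_le_left)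
    have h2 := hhi k
    have h3 := dW_le β hβ (code β k z) (1/2) half
    have h4 := hqp k
    have h5 := dW_pos β hβ (code β k z) (1/2) half
    linarith
  have hten := hden (l := l) (fun k => (p k + q k) / 2) (fun k => (q k - p k) / 2) hδ (by
    rw [hl, eventually_inf_principal]
    refine Eventually.of_forall (fun k hk => ?_)
    have hk : (MannevillePomeau β)^[k] z ∈ Ico (1/2:ℝ) 1 := hk
    rw [one_mul, hball]
    have hh := hW_code β hβ k z hzI
    have hk' : (MannevillePomeau β)^[k] z ∈ Icc (0:ℝ) 1 := Ico_subset_Icc_self (J_sub hk)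
    constructor
    · calc p k ≤ hW β (code β k z) ((MannevillePomeau β)^[k] z) := hW_mono β hβ _ _ _ half hk' hk.1
        _ = z := hh
    · calc z = hW β (code β k z) ((MannevillePomeau β)^[k] z) := hh.symm
        _ ≤ q k := hW_mono β hβ _ _ _ hk' one hk.2.le)
  simp only [hball] at hten
  set V := volume (Ico (1/2:ℝ) 1 \ Y) with hV
  have hVt : V ≤ 1 := by
    refine (measure_mono (sdiff_subset.trans J_sub)).trans ?_
    simp
  have hbound : ∀ k, volume (Y ∩ Icc (p k) (q k)) / volume (Icc (p k) (q k)) ≤ 1 - V / 2 := by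
    intro k
    have hJm : MeasurableSet (Ico (1/2:ℝ) 1 \ Y) := measurableSet_Ico.diff hYm
    have h1 := hW_vol_ge β hβ (code β k z) 1 one (Ico (1/2) 1 \ Y) (sdiff_subset.trans J_sub)
      (sdiff_subset.trans (J_sub.trans Ico_subset_Icc_self))
    have h2 : hW β (code β k z) '' (Ico (1/2) 1 \ Y) ⊆ Icc (p k) (q k) \ Y := by
      rintro _ ⟨y, ⟨hy, hyY⟩, rfl⟩
      have hy' : y ∈ Icc (0:ℝ) 1 := Ico_subset_Icc_self (J_sub hy)
      refine ⟨⟨hW_mono β hβ _ _ _ half hy' hy.1, hW_mono β hβ _ _ _ hy' one hy.2.le⟩, ?_⟩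
      refine pull_compl β hβ Y hY _ y (J_sub hy) ?_ hyY
      have := hy.1
      intro h; rw [h] at this; norm_num at this
    have h3 := h1.trans (measure_mono h2)
    have h4 : volume (Icc (p k) (q k)) ≤ 2 * ENNReal.ofReal (dW β (code β k z) 1) := by
      rw [Real.volume_Icc, ← ENNReal.ofReal_ofNat, ← ENNReal.ofReal_mul (by norm_num)]
      apply ENNReal.ofReal_le_ofReal
      have := dW_dist β hβ hβ2 (code β k z)
      have := hhi k
      linarith
    have h5 : volume (Icc (p k) (q k)) * (V / 2) ≤ volume (Icc (p k) (q k) \ Y) := by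
      refine le_trans ?_ h3
      calc _ ≤ 2 * ENNReal.ofReal (dW β (code β k z) 1) * (V / 2) := by gcongr
        _ = ENNReal.ofReal (dW β (code β k z) 1) * (2 * (V / 2)) := by ring
        _ = _ := by rw [ENNReal.mul_div_cancel (by simp) (by simp)]
    have h6 := measure_inter_add_sdiff (μ := volume) (Icc (p k) (q k)) hYm
    have hv0 : volume (Icc (p k) (q k)) ≠ 0 := by
      rw [Real.volume_Icc]; have := hqp k; simpa using this
    have hvt : volume (Icc (p k) (q k)) ≠ ⊤ := by rw [Real.volume_Icc]; simp
    rw [inter_comm Y]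
    have hV2 : V / 2 ≠ ⊤ := by
      apply ENNReal.div_ne_top (ne_top_of_le_ne_top (by simp) hVt) (by simp)
    apply ENNReal.le_sub_of_add_le_right hV2
    rw [← ENNReal.mul_le_mul_iff_right hv0 hvt, mul_add, ENNReal.mul_div_cancel hv0 hvt, mul_one]
    calc _ ≤ volume (Icc (p k) (q k) ∩ Y) + volume (Icc (p k) (q k) \ Y) := by gcongr
      _ = _ := h6
  have hlim := le_of_tendsto' hten hbound
  by_contra hne
  have hV0 : V / 2 ≠ 0 := by
    rw [Ne, ENNReal.div_eq_zero_iff]; push Not; exact ⟨hne, by simp⟩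
  have := ENNReal.sub_lt_self (a := 1) (b := V / 2) (by simp) (by simp) hV0
  exact absurd hlim (not_le.2 this)

lemma ergodic (β : ℝ) (hβ : 1 < β) (hβ2 : β < 2) (Y : Set ℝ) (hYm : MeasurableSet Y)
    (hpos : volume (Ico (0:ℝ) 1 ∩ Y) ≠ 0)
    (hY : ∀ y ∈ Ico (0:ℝ) 1, y ∈ Y → MannevillePomeau β y ≠ 0 → MannevillePomeau β y ∈ Y) :
    volume (Ico (0:ℝ) 1 \ Y) = 0 := by
  have h0 := ergodic_aux β hβ hβ2 Y hYm hpos hY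
  have one : (1:ℝ) ∈ Icc (0:ℝ) 1 := by constructor <;> norm_num
  have hs : (Ico (0:ℝ) 1 \ Y) \ {0} ⊆ Ico (0:ℝ) 1 := sdiff_subset.trans sdiff_subset
  have h1 := hW_vol_ge β hβ [true] 1 one ((Ico 0 1 \ Y) \ {0}) hs (hs.trans Ico_subset_Icc_self)
  have h2 : hW β [true] '' ((Ico 0 1 \ Y) \ {0}) ⊆ Ico (1/2:ℝ) 1 \ Y := by
    rintro _ ⟨y, ⟨⟨hy, hyY⟩, hy0⟩, rfl⟩
    refine ⟨?_, pull_compl β hβ Y hY _ y hy hy0 hyY⟩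
    simp only [hW, gB, if_true]
    constructor <;> linarith [hy.1, hy.2]
  have h3 := h1.trans (measure_mono h2)
  rw [h0, nonpos_iff_eq_zero, mul_eq_zero, measure_sdiff_null (by simp)] at h3
  rcases h3 with h3 | h3
  · have := dW_pos β hβ [true] 1 one
    rw [ENNReal.ofReal_eq_zero] at h3
    linarith
  · exact h3


/-- pairs hit at scale C/n infinitely often -/
def GoodS (β : ℝ) : Set (ℝ × ℝ) :=
  {q | ∃ C : ℕ, ∀ N : ℕ, ∃ n ≥ N, |(MannevillePomeau β)^[n] q.1 - q.2| < C / ((n:ℝ) + 1)}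

lemma GoodS_meas (β : ℝ) : MeasurableSet (GoodS β) := by
  have : GoodS β = ⋃ C : ℕ, ⋂ N : ℕ, ⋃ n : ℕ, ⋃ _ : n ≥ N, {q : ℝ × ℝ | |(MannevillePomeau β)^[n] q.1 - q.2| < C / ((n:ℝ) + 1)} := by
    ext q; simp [GoodS]
  rw [this]
  refine MeasurableSet.iUnion (fun C => MeasurableSet.iInter (fun N => MeasurableSet.iUnion (fun n => MeasurableSet.iUnion (fun _ => ?_))))
  exact measurableSet_lt ((((T_iter_meas β n).comp measurable_fst).sub measurable_snd).abs) measurable_const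

lemma T_loc_lip (β : ℝ) (hβ : 1 < β) (y : ℝ) (hy : y ∈ Ico (0:ℝ) 1) (hy2 : MannevillePomeau β y ≠ 0) :
    ∃ L ε : ℝ, 0 < L ∧ 0 < ε ∧ ∀ u ∈ Ico (0:ℝ) 1, |u - y| < ε → |MannevillePomeau β u - MannevillePomeau β y| ≤ L * |u - y| := by
  rcases lt_trichotomy y (1/2) with h | h | h
  · have hL := d0_ge β (1/2) hβ (by norm_num)
    refine ⟨d0 β (1/2), 1/2 - y, by linarith, by linarith, ?_⟩
    intro u hu huy
    have hu2 : u < 1/2 := by have := (abs_lt.1 huy).2; linarith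
    have e : ∀ t, t < 1/2 → MannevillePomeau β t = f0 β t := by
      intro t ht; simp only [MannevillePomeau, if_pos ht]; rfl
    rw [e u hu2, e y h]
    have key : ∀ s t, 0 ≤ s → s ≤ t → t < 1/2 → f0 β s ≤ f0 β t ∧ f0 β t - f0 β s ≤ d0 β (1/2) * (t - s) := by
      intro s t hs hst ht
      have h1 := f0_tangent β hβ s t hs (hs.trans hst)
      have h2 := f0_tangent β hβ t s (hs.trans hst) hs
      have h3 := d0_ge β s hβ hs
      have h4 : d0 β t ≤ d0 β (1/2) := by
        unfold d0
        have : 0 ≤ β - 1 := by linarith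
        have : 0 ≤ t := hs.trans hst
        gcongr
      constructor <;> nlinarith
    exact abs_mono_aux _ _ _ _ _ (fun hh => key u y hu.1 hh h) (fun hh => key y u hy.1 hh hu2)
  · exfalso; apply hy2; rw [h]; simp only [MannevillePomeau]; norm_num
  · refine ⟨2, y - 1/2, by norm_num, by linarith, ?_⟩
    intro u hu huy
    have hu2 : 1/2 < u := by have := (abs_lt.1 huy).1; linarith
    simp only [MannevillePomeau, if_neg (not_lt.2 hu2.le), if_neg (not_lt.2 h.le)]
    rw [show 2 * u - 1 - (2 * y - 1) = 2 * (u - y) by ring, abs_mul]; norm_num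

lemma Good_snd (β : ℝ) (hβ : 1 < β) (x y : ℝ) (hx : x ∈ Ico (0:ℝ) 1) (hy : y ∈ Ico (0:ℝ) 1) (hy2 : MannevillePomeau β y ≠ 0)
    (h : (x, y) ∈ GoodS β) : (x, MannevillePomeau β y) ∈ GoodS β := by
  obtain ⟨C, hC⟩ := h
  obtain ⟨L, ε, hL, hε, hlip⟩ := T_loc_lip β hβ y hy hy2
  obtain ⟨C', hC'⟩ := exists_nat_gt (2 * L * C)
  refine ⟨C', ?_⟩
  intro N
  obtain ⟨M, hM⟩ := exists_nat_gt (C / ε)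
  obtain ⟨n, hn, hclose⟩ := hC (N + M)
  simp only at hclose
  refine ⟨n + 1, by omega, ?_⟩
  simp only
  rw [Function.iterate_succ_apply']
  have hnM : (M:ℝ) ≤ n := by exact_mod_cast (by omega : M ≤ n)
  have hn0 : (0:ℝ) < (n:ℝ) + 1 := by positivity
  have hsm : (C:ℝ) / ((n:ℝ) + 1) ≤ ε := by
    rw [div_le_iff₀ hn0]
    rw [div_lt_iff₀ hε] at hM
    nlinarith
  refine (hlip _ (T_iter_mem β hβ n x hx) (hclose.trans_le hsm)).trans_lt ?_
  push_cast
  calc L * |(MannevillePomeau β)^[n] x - y| ≤ L * (C / ((n:ℝ) + 1)) := by gcongr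
    _ = (2 * L * C) / (2 * ((n:ℝ) + 1)) := by field_simp
    _ ≤ (2 * L * C) / ((n:ℝ) + 1 + 1) := by gcongr; linarith
    _ < C' / ((n:ℝ) + 1 + 1) := by gcongr

lemma Good_fst (β : ℝ) (x y : ℝ) (h : (x, y) ∈ GoodS β) : (MannevillePomeau β x, y) ∈ GoodS β := by
  obtain ⟨C, hC⟩ := h
  refine ⟨C, fun N => ?_⟩
  obtain ⟨n, hn, hclose⟩ := hC (N + 1)
  obtain ⟨m, rfl⟩ : ∃ m, n = m + 1 := ⟨n - 1, by omega⟩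
  refine ⟨m, by omega, ?_⟩
  simp only at *
  rw [← Function.iterate_succ_apply (MannevillePomeau β)]
  refine hclose.trans_le ?_
  push_cast
  gcongr
  linarith

lemma good_ae (β : ℝ) (hβ : 1 < β) (hβ2 : β < 2) :
    ∀ᵐ x ∂(volume : Measure ℝ), x ∈ Ico (0:ℝ) 1 → ∀ᵐ y ∂(volume : Measure ℝ), y ∈ Ico (0:ℝ) 1 → (x, y) ∈ GoodS β := by
  have hGI : MeasurableSet ({q : ℝ × ℝ | q.2 ∈ Ico (0:ℝ) 1} ∩ GoodS β) := (measurable_snd measurableSet_Ico).inter (GoodS_meas β)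
  have hsec : ∀ x, Prod.mk x ⁻¹' ({q : ℝ × ℝ | q.2 ∈ Ico (0:ℝ) 1} ∩ GoodS β) = Ico (0:ℝ) 1 ∩ {y | (x, y) ∈ GoodS β} := fun x => rfl
  set X : Set ℝ := {x | volume (Ico (0:ℝ) 1 ∩ {y | (x, y) ∈ GoodS β}) ≠ 0} with hX
  have hXm : MeasurableSet X := by
    have h1 : Measurable (fun x => volume (Prod.mk x ⁻¹' ({q : ℝ × ℝ | q.2 ∈ Ico (0:ℝ) 1} ∩ GoodS β))) := measurable_measure_prodMk_left hGI
    exact (h1 (measurableSet_singleton 0)).compl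
  have hXpos : volume (Ico (0:ℝ) 1 ∩ X) ≠ 0 := by
    intro h0
    have hp := hit_pos β hβ hβ2
    apply hp.ne'
    rw [Measure.volume_eq_prod, Measure.measure_prod_null (MeasurableSet.iInter (hitB_meas β))]
    rw [measure_eq_zero_iff_ae_notMem] at h0
    filter_upwards [h0] with x hx
    by_cases hxI : x ∈ Ico (0:ℝ) 1
    · have hxX : volume (Ico (0:ℝ) 1 ∩ {y | (x, y) ∈ GoodS β}) = 0 := by
        by_contra hc; exact hx ⟨hxI, hc⟩
      refine measure_mono_null ?_ hxX
      intro y hy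
      have hy : ∀ n0, (x, y) ∈ hitB β n0 := by simpa using hy
      refine ⟨J_sub (hy 0).2.1, 1, fun N => ?_⟩
      obtain ⟨_, _, n, hn, h⟩ := hy N
      exact ⟨n, hn, by simpa using h⟩
    · have : Prod.mk x ⁻¹' (⋂ n0, hitB β n0) = ∅ := by
        ext y; simp only [mem_preimage, mem_iInter, mem_empty_iff_false, iff_false]
        intro h; exact hxI (h 0).1
      rw [this]; simp
  have hXfull := ergodic β hβ hβ2 X hXm hXpos (by
    intro x _ hx _ hc
    apply hx
    refine measure_mono_null ?_ hc
    rintro y ⟨h1, h2⟩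
    exact ⟨h1, Good_fst β x y h2⟩)
  rw [measure_eq_zero_iff_ae_notMem] at hXfull
  filter_upwards [hXfull] with x hx hxI
  have hxX : x ∈ X := by by_contra hc; exact hx ⟨hxI, hc⟩
  have hfull := ergodic β hβ hβ2 {y | (x, y) ∈ GoodS β} (measurable_prodMk_left (GoodS_meas β)) hxX
    (fun y hy h1 h2 => Good_snd β hβ x y hxI hy h2 h1)
  rw [measure_eq_zero_iff_ae_notMem] at hfull
  filter_upwards [hfull] with y hy hyI
  by_contra hc; exact hy ⟨hyI, hc⟩

lemma lower_dim (β : ℝ) (α : ℝ) (hα : 1 ≤ α) (r : ℕ → ℝ) (hr : ∀ j : ℕ, r j = (j : ℝ) ^ (-α)) (x : ℝ)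
    (hx : ∀ᵐ y ∂(volume : Measure ℝ), y ∈ Ico (0:ℝ) 1 → (x, y) ∈ GoodS β) (s : ℝ) (hs0 : 0 < s) (hs : s < 1 / α) :
    ENNReal.ofReal s ≤ dimH (hitSet (MannevillePomeau β) x r) := by
  have hα0 : 0 < α := by linarith
  have hs1 : s < 1 := hs.trans_le (by rw [div_le_one hα0]; exact hα)
  have hsα : 0 < 1 - α * s := by
    rw [lt_div_iff₀ hα0] at hs; linarith
  refine mtp (fun n => (MannevillePomeau β)^[n] x) r s hs0 hs1 ?_
  filter_upwards [hx] with y hy hyI κ hκ N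
  obtain ⟨C, hC⟩ := hy ⟨hyI.1.le, hyI.2⟩
  have ht : Tendsto (fun n : ℕ => (n:ℝ) ^ (1 - α * s)) atTop atTop :=
    (tendsto_rpow_atTop hsα).comp tendsto_natCast_atTop_atTop
  have e1 := ht.eventually_ge_atTop ((2 * C + 4) / κ)
  have e2 := (tendsto_natCast_atTop_atTop (R := ℝ)).eventually_gt_atTop ((2 * C + 4) / κ)
  obtain ⟨M, hM⟩ := eventually_atTop.1 (e1.and (e2.and (eventually_ge_atTop 1)))
  obtain ⟨n, hn, hclose⟩ := hC (N + M)
  obtain ⟨h1, h2, h3⟩ := hM n (by omega)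
  have hn1 : (1:ℝ) ≤ n := by exact_mod_cast h3
  have hn0 : (0:ℝ) < n := by linarith
  simp only at hclose
  refine ⟨n, by omega, (2 * C + 4) / n, by positivity, ?_, ?_, ?_, ?_, ?_⟩
  · rw [div_lt_iff₀ hκ] at h2; rw [div_lt_iff₀ hn0]; linarith
  · rw [hr]; positivity
  · refine hclose.le.trans ?_
    rw [div_div, div_le_div_iff₀ (by positivity) (by positivity)]
    have : (0:ℝ) ≤ C := by positivity
    nlinarith
  · rw [hr]
    have : (n:ℝ) ^ (-α) ≤ (n:ℝ) ^ (-1:ℝ) := Real.rpow_le_rpow_of_exponent_le hn1 (by linarith)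
    rw [Real.rpow_neg_one] at this
    refine this.trans ?_
    rw [div_div, ← one_div, div_le_div_iff₀ hn0 (by positivity)]
    have : (0:ℝ) ≤ C := by positivity
    nlinarith
  · rw [hr, ← Real.rpow_mul hn0.le]
    rw [div_le_iff₀ hκ] at h1
    rw [div_le_iff₀ hn0]
    refine h1.trans (le_of_eq ?_)
    have : (n:ℝ) ^ (1 - α * s) = (n:ℝ) ^ (-α * s) * n := by
      rw [show 1 - α * s = -α * s + 1 by ring, Real.rpow_add_one hn0.ne']
    rw [this]; ring

lemma final_aux (β : ℝ) (hβ₁ : 1 < β) (hβ₂ : β < 2)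
    (α : ℝ) (hα : 1 ≤ α)
    (r : ℕ → ℝ) (hr : ∀ j : ℕ, r j = (j : ℝ) ^ (-α)) :
    ∀ᵐ x ∂(volume : Measure ℝ), x ∈ Set.Ico (0:ℝ) 1 →
      dimH (hitSet (MannevillePomeau β) x r) = ENNReal.ofReal (1 / α) := by
  filter_upwards [good_ae β hβ₁ hβ₂] with x hx hxI
  apply le_antisymm
  · exact upper_dim (MannevillePomeau β) x α hα r hr
  · have hα0 : 0 < α := by linarith
    apply le_of_forall_lt_imp_le_of_dense
    intro a ha
    have hat : a ≠ ⊤ := ne_top_of_lt ha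
    have hlt : a.toReal < 1 / α := by
      rw [← ENNReal.ofReal_toReal hat, ENNReal.ofReal_lt_ofReal_iff (by positivity)] at ha
      exact ha
    have hh : 1 / (2 * α) < 1 / α := by
      apply one_div_lt_one_div_of_lt hα0; linarith
    have := lower_dim β α hα r hr x (hx hxI) (max a.toReal (1 / (2 * α))) (lt_max_of_lt_right (by positivity)) (max_lt hlt hh)
    refine le_trans ?_ this
    rw [← ENNReal.ofReal_toReal hat]
    apply ENNReal.ofReal_le_ofReal
    rw [ENNReal.ofReal_toReal hat]
    exact le_max_left _ _

theorem stmt_5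
    (β : ℝ) (hβ₁ : 1 < β) (hβ₂ : β < 2)
    (α : ℝ) (hα : 1 ≤ α)
    (r : ℕ → ℝ) (hr : ∀ j : ℕ, r j = (j : ℝ) ^ (-α)) :
    ∀ᵐ x ∂(volume : Measure ℝ), x ∈ Set.Ico (0:ℝ) 1 →
      dimH (hitSet (MannevillePomeau β) x r) = ENNReal.ofReal (1 / α) := by
  exact final_aux β hβ₁ hβ₂ α hα r hr
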